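/- Fix λ ∈ (0,1/2), a cutoff ζ, γ ∈ [0,1), a kernel K satisfying the standing assumptions, ρ ∈ (γ,1), β = 1/(ρ−γ), and t ∈ [0,T]. The solution map S_λ(t) : 𝒳_ρ → 𝒳_ρ, which sends an initial measure h₀ to h(·,t) where h(x,t) = H(x e^{βt}, t) and H is the unique global mild solution of the regularized problem with kernel K_λ and initial datum h₀, is continuous with respect to the weak topology of measures: if h_{0,n} ⇀ h₀ weakly with sup_n ‖h_{0,n}‖_{𝒳_ρ} < ∞, then S_λ(t)h_{0,n} ⇀ S_λ(t)h₀ weakly. -/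

import Mathlib

open MeasureTheory Real Set Filter Topology

noncomputable section

namespace Smol

/-- Standing assumptions on the coagulation kernel `K`: continuity on `(0,∞)²`, symmetry,
nonnegativity, homogeneity of degree `γ` and the growth bound `K(x,y) ≤ C(x^γ + y^γ)`. -/
structure KernelHyp (K : ℝ → ℝ → ℝ) (γ C : ℝ) : Prop where
  cont : ContinuousOn (fun p : ℝ × ℝ => K p.1 p.2) (Ioi (0:ℝ) ×ˢ Ioi (0:ℝ))
  symm : ∀ x y : ℝ, 0 < x → 0 < y → K x y = K y x
  nonneg : ∀ x y : ℝ, 0 < x → 0 < y → 0 ≤ K x y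
  homog : ∀ a x y : ℝ, 0 < a → 0 < x → 0 < y → K (a * x) (a * y) = a ^ γ * K x y
  growth : ∀ x y : ℝ, 0 < x → 0 < y → K x y ≤ C * (x ^ γ + y ^ γ)

/-- A smooth monotone cutoff `ζ`, vanishing on `[0,1/2]` and equal to `1` on `[1,∞)`. -/
structure CutoffHyp (ζ : ℝ → ℝ) : Prop where
  smooth : ContDiffOn ℝ (⊤ : ℕ∞) ζ (Ici (0:ℝ))
  mono : MonotoneOn ζ (Ici (0:ℝ))
  zero : ∀ s : ℝ, s ≤ 1/2 → ζ s = 0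
  one : ∀ s : ℝ, 1 ≤ s → ζ s = 1

/-- The regularized kernel `K_λ`. -/
def Kreg (K : ℝ → ℝ → ℝ) (ζ : ℝ → ℝ) (lam : ℝ) (y z : ℝ) : ℝ :=
  K y z * ζ (y / lam) * ζ (z / lam) * ζ (y / (lam * (y + z))) * ζ (z / (lam * (y + z)))

/-- Membership in the space `𝒳_ρ` of nonnegative Radon measures on `[0,∞)` with
`sup_{R>0} (∫_{[0,R]} dh)/R^{1-ρ} < ∞`. -/
def MemX (ρ : ℝ) (μ : Measure ℝ) : Prop :=
  μ (Iio 0) = 0 ∧ ∃ M : ℝ, ∀ R > (0:ℝ), μ (Icc 0 R) ≤ ENNReal.ofReal (M * R ^ (1 - ρ))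

/-- The norm `‖h‖_{𝒳_ρ} = sup_{R>0} (∫_{[0,R]} dh)/R^{1-ρ}`, expressed as the least
admissible constant. -/
def Xnorm (ρ : ℝ) (μ : Measure ℝ) : ℝ :=
  sInf {M : ℝ | 0 ≤ M ∧ ∀ R > (0:ℝ), μ (Icc 0 R) ≤ ENNReal.ofReal (M * R ^ (1 - ρ))}

/-- The operator `𝒜[H](X,t) = ∫_0^∞ K_λ(Xe^{-βt},Ze^{-βt})/Z dH(Z,t) - βρ`. -/
def Acal (Kl : ℝ → ℝ → ℝ) (β ρ : ℝ) (H : ℝ → Measure ℝ) (X t : ℝ) : ℝ :=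
  (∫ Z, Kl (X * exp (-(β * t))) (Z * exp (-(β * t))) / Z ∂(H t)) - β * ρ

/-- The measure `𝒬[H](·,t)`, i.e. the weighted convolution
`𝒬[H](X,t) = ∫_0^X (K_λ(Ye^{-βt},(X-Y)e^{-βt})/(X-Y)) H(X-Y,t) dH(Y,t)`. -/
def Qcal (Kl : ℝ → ℝ → ℝ) (β : ℝ) (H : ℝ → Measure ℝ) (t : ℝ) : Measure ℝ :=
  Measure.map (fun p : ℝ × ℝ => p.1 + p.2)
    (((H t).prod (H t)).withDensity fun p =>
      ENNReal.ofReal (Kl (p.1 * exp (-(β * t))) (p.2 * exp (-(β * t))) / p.2))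

/-- Mild solution on `[0,T]` of the regularized problem, in the sense of measures:
`H(·,t) = h₀ e^{-∫_0^t 𝒜[H] ds} + ∫_0^t e^{-∫_s^t 𝒜[H] dξ} 𝒬[H](·,s) ds`,
together with membership in `C([0,T];𝒳_ρ)` (weak continuity in time). -/
def IsMildSolution (Kl : ℝ → ℝ → ℝ) (β ρ T : ℝ) (h0 : Measure ℝ)
    (H : ℝ → Measure ℝ) : Prop :=
  (∀ t ∈ Icc (0:ℝ) T, MemX ρ (H t)) ∧
  (∀ φ : ℝ → ℝ, Continuous φ → HasCompactSupport φ →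
      ContinuousOn (fun t => ∫ X, φ X ∂(H t)) (Icc (0:ℝ) T)) ∧
  (∀ t ∈ Icc (0:ℝ) T, ∀ φ : ℝ → ℝ, Continuous φ → HasCompactSupport φ →
      ∫ X, φ X ∂(H t)
        = (∫ X, φ X * exp (-(∫ s in (0:ℝ)..t, Acal Kl β ρ H X s)) ∂h0)
          + ∫ s in (0:ℝ)..t,
              ∫ X, φ X * exp (-(∫ ξ in s..t, Acal Kl β ρ H X ξ)) ∂(Qcal Kl β H s))

/-- The change of variables producing `h(·,t)` from `H(·,t)`:
`h(x,t) = H(xe^{βt},t)` as densities, i.e. `h(·,t) = e^{-βt}·(X ↦ Xe^{-βt})_*H(·,t)`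
as measures; `S_λ(t)h₀` is `Smap β t (H t)` for the mild solution `H` with datum `h₀`. -/
def Smap (β t : ℝ) (ν : Measure ℝ) : Measure ℝ :=
  ENNReal.ofReal (exp (-(β * t))) • Measure.map (fun X => X * exp (-(β * t))) ν

lemma hasCompactSupport_of_abs {f : ℝ → ℝ} {R : ℝ} (h : ∀ x, R < |x| → f x = 0) :
    HasCompactSupport f := by
  refine HasCompactSupport.intro (isCompact_Icc (a := -R) (b := R)) fun x hx => h x ?_
  by_contra hR
  exact hx (abs_le.1 (not_lt.1 hR))

lemma exists_abs_of_hasCompactSupport {f : ℝ → ℝ} (h : HasCompactSupport f) :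
    ∃ R, 0 < R ∧ ∀ x, R < |x| → f x = 0 := by
  obtain ⟨R, hR⟩ := h.isCompact.isBounded.subset_closedBall 0
  refine ⟨max R 1, by positivity, fun x hx => ?_⟩
  by_contra hne
  have := hR (subset_tsupport f hne)
  rw [mem_closedBall_zero_iff, norm_eq_abs] at this
  exact absurd (this.trans (le_max_left _ _)) (not_le.2 hx)

lemma hasCompactSupport_uncurry_of_abs {F : ℝ → ℝ → ℝ} {R R' : ℝ}
    (h : ∀ x y, R < |x| → F x y = 0) (h' : ∀ x y, R' < |y| → F x y = 0) :
    HasCompactSupport (Function.uncurry F) := by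
  refine HasCompactSupport.intro
    ((isCompact_Icc (a := -R) (b := R)).prod (isCompact_Icc (a := -R') (b := R'))) ?_
  rintro ⟨x, y⟩ hxy
  by_contra hne
  refine hxy ⟨abs_le.1 ?_, abs_le.1 ?_⟩
  · exact not_lt.1 fun hx => hne (h x y hx)
  · exact not_lt.1 fun hy => hne (h' x y hy)

lemma abs_integral_le_of_abs {ν : Measure ℝ} [IsLocallyFiniteMeasure ν] {f : ℝ → ℝ} {R B : ℝ}
    (hs : ∀ x, R < |x| → f x = 0) (hB : ∀ x, |x| ≤ R → |f x| ≤ B) :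
    |∫ x, f x ∂ν| ≤ B * ν.real (Icc (-R) R) := by
  rw [← setIntegral_eq_integral_of_forall_compl_eq_zero (s := Icc (-R) R)
    (fun x hx => hs x (not_le.1 fun h => hx (abs_le.1 h)))]
  exact norm_setIntegral_le_of_norm_le_const (f := f) (C := B) isCompact_Icc.measure_lt_top
    (fun x hx => hB x (abs_le.2 hx))

lemma integrable_of_abs {ν : Measure ℝ} [IsLocallyFiniteMeasure ν] {f : ℝ → ℝ} {R : ℝ}
    (hf : Continuous f) (hs : ∀ x, R < |x| → f x = 0) : Integrable f ν :=
  hf.integrable_of_hasCompactSupport (hasCompactSupport_of_abs hs)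

lemma tendsto_integral_of_tendstoUniformlyOn {ι : Type*} {l : Filter ι} {ν : ι → Measure ℝ}
    {ν₀ : Measure ℝ} [∀ i, IsLocallyFiniteMeasure (ν i)] {F : ι → ℝ → ℝ} {F₀ : ℝ → ℝ} {R M : ℝ}
    (hM : ∀ᶠ i in l, (ν i).real (Icc (-R) R) ≤ M) (hF : ∀ᶠ i in l, Continuous (F i))
    (hF₀ : Continuous F₀)
    (hs : ∀ᶠ i in l, ∀ x, R < |x| → F i x = 0) (hs₀ : ∀ x, R < |x| → F₀ x = 0)
    (hu : TendstoUniformlyOn F F₀ l (Icc (-R) R))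
    (hν : Tendsto (fun i => ∫ x, F₀ x ∂ν i) l (𝓝 (∫ x, F₀ x ∂ν₀))) :
    Tendsto (fun i => ∫ x, F i x ∂ν i) l (𝓝 (∫ x, F₀ x ∂ν₀)) := by
  suffices h : Tendsto (fun i => (∫ x, F i x ∂ν i) - ∫ x, F₀ x ∂ν i) l (𝓝 0) by
    simpa using h.add hν
  rw [Metric.tendsto_nhds]
  intro ε hε
  have hM1 : 0 < |M| + 1 := by positivity
  filter_upwards [hM, hF, hs, Metric.tendstoUniformlyOn_iff.1 hu (ε / (|M| + 1)) (by positivity)]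
    with i hMi hFi hsi hui
  rw [dist_zero_right, norm_eq_abs, ← integral_sub (integrable_of_abs hFi hsi)
    (integrable_of_abs hF₀ hs₀)]
  calc |∫ x, F i x - F₀ x ∂ν i| ≤ ε / (|M| + 1) * (ν i).real (Icc (-R) R) := by
        refine abs_integral_le_of_abs (fun x hx => by rw [hsi x hx, hs₀ x hx, sub_zero]) ?_
        intro x hx
        rw [abs_sub_comm]
        exact (hui x (abs_le.1 hx)).le
    _ ≤ ε / (|M| + 1) * |M| := by gcongr; exact hMi.trans (le_abs_self _)
    _ < ε / (|M| + 1) * (|M| + 1) := by gcongr; linarith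
    _ = ε := by field_simp

lemma tendstoUniformlyOn_of_continuous_uncurry {P : Type*} [TopologicalSpace P]
    {F : P → ℝ → ℝ} (hF : Continuous (Function.uncurry F)) (p : P) {S : Set ℝ}
    (hS : IsCompact S) : TendstoUniformlyOn F (F p) (𝓝 p) S := by
  have h := (ContinuousMap.curry ⟨Function.uncurry F, hF⟩).continuous.tendsto p
  exact ContinuousMap.tendsto_iff_forall_isCompact_tendstoUniformlyOn.1 h S hS

/-- A family of locally finite measures depending on a time, weakly continuous and with
locally bounded mass uniformly in time. -/
structure IsFlow (μ : ℝ → Measure ℝ) : Prop where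
  locallyFinite : ∀ t, IsLocallyFiniteMeasure (μ t)
  bounded : ∀ R, ∃ M, ∀ t, (μ t).real (Icc (-R) R) ≤ M
  continuous : ∀ φ : ℝ → ℝ, Continuous φ → HasCompactSupport φ →
    Continuous fun t => ∫ x, φ x ∂μ t

lemma IsFlow.continuous_integral {μ : ℝ → Measure ℝ} (hμ : IsFlow μ) {P : Type*}
    [TopologicalSpace P] {F : P → ℝ → ℝ} {τ : P → ℝ} (hF : Continuous (Function.uncurry F))
    (hτ : Continuous τ)
    (hs : ∀ p, ∃ R, ∀ᶠ q in 𝓝 p, ∀ x, R < |x| → F q x = 0) :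
    Continuous fun p => ∫ x, F p x ∂μ (τ p) := by
  have := hμ.locallyFinite
  rw [continuous_iff_continuousAt]
  intro p
  obtain ⟨R, hR⟩ := hs p
  obtain ⟨M, hM⟩ := hμ.bounded R
  have hFp : ∀ q, Continuous (F q) := fun q => hF.comp (by fun_prop : Continuous fun x => (q, x))
  exact tendsto_integral_of_tendstoUniformlyOn (.of_forall fun q => hM (τ q)) (.of_forall hFp)
    (hFp p) hR hR.self_of_nhds
    (tendstoUniformlyOn_of_continuous_uncurry hF p isCompact_Icc)
    (((hμ.continuous _ (hFp p) (hasCompactSupport_of_abs hR.self_of_nhds)).comp hτ).tendsto p)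

lemma integral_intervalIntegral_swap {ν : Measure ℝ} [IsLocallyFiniteMeasure ν]
    {G : ℝ → ℝ → ℝ} {R : ℝ} (hG : Continuous (Function.uncurry G))
    (hs : ∀ r x, R < |x| → G r x = 0) (s t : ℝ) :
    ∫ x, (∫ r in s..t, G r x) ∂ν = ∫ r in s..t, ∫ x, G r x ∂ν := by
  symm
  refine intervalIntegral_integral_swap ?_
  have h1 : IntegrableOn (Function.uncurry G) (uIcc s t ×ˢ Icc (-R) R) (volume.prod ν) :=
    hG.continuousOn.integrableOn_compact (isCompact_uIcc.prod isCompact_Icc)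
  have h2 : IntegrableOn (Function.uncurry G) (uIcc s t ×ˢ univ) (volume.prod ν) := by
    refine h1.of_forall_sdiff_eq_zero (isCompact_uIcc.measurableSet.prod MeasurableSet.univ) ?_
    rintro ⟨r, x⟩ ⟨⟨hr, -⟩, hx⟩
    exact hs r x (not_le.1 fun h => hx ⟨hr, abs_le.1 h⟩)
  have h3 := h2.mono_set (prod_mono (uIoc_subset_uIcc (a := s) (b := t)) subset_rfl)
  rwa [IntegrableOn, ← Measure.prod_restrict, Measure.restrict_univ] at h3

lemma intervalIntegral_triangle_swap {G : ℝ → ℝ → ℝ} (hG : Continuous (Function.uncurry G))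
    {t : ℝ} (ht : 0 ≤ t) :
    ∫ s in 0..t, ∫ r in s..t, G s r = ∫ r in 0..t, ∫ s in 0..r, G s r := by
  have hm : MeasurableSet {p : ℝ × ℝ | p.1 < p.2} := measurableSet_lt measurable_fst measurable_snd
  have h := intervalIntegral_intervalIntegral_swap (a := 0) (b := t) (c := 0) (d := t)
    (F := fun s r => {p : ℝ × ℝ | p.1 < p.2}.indicator (Function.uncurry G) (s, r)) (by
      refine IntegrableOn.mono_set ?_ (prod_mono uIoc_subset_uIcc uIoc_subset_uIcc)
      exact (hG.continuousOn.integrableOn_compact (isCompact_uIcc.prod isCompact_uIcc)).indicator hm)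
  have h1 : ∫ s in 0..t, ∫ r in s..t, G s r = ∫ s in 0..t, ∫ r in 0..t,
      {p : ℝ × ℝ | p.1 < p.2}.indicator (Function.uncurry G) (s, r) := by
    refine intervalIntegral.integral_congr fun s hs => ?_
    rw [uIcc_of_le ht] at hs
    rw [intervalIntegral.integral_of_le hs.2, intervalIntegral.integral_of_le ht,
      ← integral_indicator measurableSet_Ioc, ← integral_indicator measurableSet_Ioc]
    congr 1 with r
    simp only [indicator, mem_Ioc, mem_ofPred_eq, Function.uncurry]
    have := hs.1
    grind
  have h2 : ∫ r in 0..t, ∫ s in 0..r, G s r = ∫ r in 0..t, ∫ s in 0..t,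
      {p : ℝ × ℝ | p.1 < p.2}.indicator (Function.uncurry G) (s, r) := by
    refine intervalIntegral.integral_congr fun r hr => ?_
    rw [uIcc_of_le ht] at hr
    rw [intervalIntegral.integral_of_le hr.1, intervalIntegral.integral_of_le ht,
      integral_Ioc_eq_integral_Ioo,
      ← integral_indicator measurableSet_Ioo, ← integral_indicator measurableSet_Ioc]
    congr 1 with s
    simp only [indicator, mem_Ioc, mem_Ioo, mem_ofPred_eq, Function.uncurry]
    have := hr.2
    grind
  rw [h1, h2, h]

section

/-- A time-dependent coagulation rate which is continuous, supported where the two sizes are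
comparable, and decaying like `Z ^ (-σ)`. -/
structure IsRate (b : ℝ → ℝ → ℝ → ℝ) (c C₀ σ : ℝ) : Prop where
  one_le : 1 ≤ c
  continuous : Continuous fun p : ℝ × ℝ × ℝ => b p.1 p.2.1 p.2.2
  nonneg : ∀ t Y Z, 0 ≤ b t Y Z
  comparable : ∀ t Y Z, b t Y Z ≠ 0 → 0 < Y ∧ 0 < Z ∧ Z ≤ c * Y ∧ Y ≤ c * Z
  bound : ∀ t Y Z, 0 < Z → b t Y Z * Z ^ σ ≤ C₀

/-- The loss rate `∫ b(s,X,Z) dμ_s(Z) - κ`. -/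
def lossRate (b : ℝ → ℝ → ℝ → ℝ) (κ : ℝ) (μ : ℝ → Measure ℝ) (X s : ℝ) : ℝ :=
  (∫ Z, b s X Z ∂μ s) - κ

/-- The damping factor `exp (-∫_s^t A(X,ξ) dξ)`. -/
def damp (A : ℝ → ℝ → ℝ) (X s t : ℝ) : ℝ := exp (-∫ ξ in s..t, A X ξ)

/-- The gain term `∬ b(s,Y,Z) ψ(Y+Z) dμ_s dμ_s`. -/
def gain (b : ℝ → ℝ → ℝ → ℝ) (μ : ℝ → Measure ℝ) (ψ : ℝ → ℝ) (s : ℝ) : ℝ :=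
  ∫ Y, ∫ Z, ψ (Y + Z) * b s Y Z ∂μ s ∂μ s

/-- The mild formulation, tested against continuous compactly supported functions. -/
def IsMildFlow (b : ℝ → ℝ → ℝ → ℝ) (κ T : ℝ) (μ : ℝ → Measure ℝ) : Prop :=
  ∀ t ∈ Icc 0 T, ∀ φ : ℝ → ℝ, Continuous φ → HasCompactSupport φ →
    ∫ x, φ x ∂μ t = (∫ x, φ x * damp (lossRate b κ μ) x 0 t ∂μ 0)
      + ∫ s in 0..t, gain b μ (fun x => φ x * damp (lossRate b κ μ) x s t) s

variable {b : ℝ → ℝ → ℝ → ℝ} {c C₀ σ κ T : ℝ} {μ : ℝ → Measure ℝ}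

lemma IsRate.eq_zero (hb : IsRate b c C₀ σ) {t Y Z : ℝ}
    (h : ¬ (0 < Y ∧ 0 < Z ∧ Z ≤ c * Y ∧ Y ≤ c * Z)) : b t Y Z = 0 := by
  by_contra h'
  exact h (hb.comparable t Y Z h')

lemma IsRate.comp_continuous (hb : IsRate b c C₀ σ) {P : Type*} [TopologicalSpace P]
    {f g h : P → ℝ} (hf : Continuous f) (hg : Continuous g) (hh : Continuous h) :
    Continuous fun p => b (f p) (g p) (h p) :=
  hb.continuous.comp (hf.prodMk (hg.prodMk hh))

lemma IsRate.eventually_eq_zero (hb : IsRate b c C₀ σ) (X₀ : ℝ) :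
    ∀ᶠ X in 𝓝 X₀, ∀ s Z, c * (|X₀| + 1) < |Z| → b s X Z = 0 := by
  filter_upwards [Metric.ball_mem_nhds X₀ one_pos] with X hX s Z hZ
  refine hb.eq_zero ?_
  rintro ⟨h1, h2, h3, h4⟩
  rw [abs_of_pos h2] at hZ
  have hX' : |X| - |X₀| < 1 := lt_of_le_of_lt (abs_sub_abs_le_abs_sub X X₀) hX
  rw [abs_of_pos h1] at hX'
  have := hb.one_le
  nlinarith

lemma IsFlow.continuous_lossRate (hμ : IsFlow μ) (hb : IsRate b c C₀ σ) (κ : ℝ) :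
    Continuous fun p : ℝ × ℝ => lossRate b κ μ p.1 p.2 := by
  refine Continuous.sub ?_ continuous_const
  refine hμ.continuous_integral (F := fun (p : ℝ × ℝ) Z => b p.2 p.1 Z) (τ := Prod.snd)
    (hb.comp_continuous (by fun_prop) (by fun_prop) (by fun_prop)) continuous_snd ?_
  intro p
  refine ⟨c * (|p.1| + 1), ?_⟩
  filter_upwards [continuous_fst.continuousAt.eventually (hb.eventually_eq_zero p.1)] with q hq x hx
    using hq _ x hx

lemma continuous_damp {A : ℝ → ℝ → ℝ} (hA : Continuous fun p : ℝ × ℝ => A p.1 p.2) :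
    Continuous fun p : ℝ × ℝ × ℝ => damp A p.1 p.2.1 p.2.2 := by
  have hI : Continuous fun p : ℝ × ℝ => ∫ ξ in 0..p.2, A p.1 ξ :=
    intervalIntegral.continuous_parametric_intervalIntegral_of_continuous
      (f := fun (p : ℝ × ℝ) ξ => A p.1 ξ) (by
        exact hA.comp (by fun_prop : Continuous fun q : (ℝ × ℝ) × ℝ => (q.1.1, q.2)))
      continuous_snd
  have hintegral : ∀ X s t, IntervalIntegrable (A X) volume s t := fun X s t =>
    (hA.comp (by fun_prop : Continuous fun ξ : ℝ => (X, ξ))).intervalIntegrable s t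
  have : (fun p : ℝ × ℝ × ℝ => damp A p.1 p.2.1 p.2.2) = fun p : ℝ × ℝ × ℝ =>
      exp (-((∫ ξ in 0..p.2.2, A p.1 ξ) - ∫ ξ in 0..p.2.1, A p.1 ξ)) := by
    funext p
    rw [intervalIntegral.integral_interval_sub_left (hintegral _ _ _) (hintegral _ _ _), damp]
  rw [this]
  have h1 := hI.comp (by fun_prop : Continuous fun p : ℝ × ℝ × ℝ => (p.1, p.2.2))
  have h2 := hI.comp (by fun_prop : Continuous fun p : ℝ × ℝ × ℝ => (p.1, p.2.1))
  exact (h1.sub h2).neg.rexp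

lemma damp_eq_one_sub {A : ℝ → ℝ → ℝ} (hA : Continuous fun p : ℝ × ℝ => A p.1 p.2)
    (X s t : ℝ) : damp A X s t = 1 - ∫ r in s..t, A X r * damp A X s r := by
  have hAX : Continuous (A X) := hA.comp (by fun_prop : Continuous fun ξ : ℝ => (X, ξ))
  have hd : ∀ r, HasDerivAt (fun r => -damp A X s r) (A X r * damp A X s r) r := by
    intro r
    have := (intervalIntegral.integral_hasDerivAt_right (hAX.intervalIntegrable s r)
      (hAX.stronglyMeasurableAtFilter _ _) hAX.continuousAt).neg.exp.neg
    refine this.congr_deriv ?_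
    simp only [damp, Pi.neg_apply]
    ring
  have hc : Continuous fun r => A X r * damp A X s r := hAX.mul
    ((continuous_damp hA).comp (by fun_prop : Continuous fun r : ℝ => (X, s, r)))
  rw [intervalIntegral.integral_eq_sub_of_hasDerivAt (fun r _ => hd r) (hc.intervalIntegrable _ _)]
  simp [damp]

lemma IsRate.gain_integrand_eq_zero (hb : IsRate b c C₀ σ) {ψ : ℝ → ℝ} {R s : ℝ}
    (hs : ∀ x, R < |x| → ψ x = 0) {Y Z : ℝ} (h : R < |Y| ∨ R < |Z|) :
    ψ (Y + Z) * b s Y Z = 0 := by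
  by_cases hYZ : 0 < Y ∧ 0 < Z
  · rw [hs, zero_mul]
    rw [abs_of_pos hYZ.1, abs_of_pos hYZ.2] at h
    rw [abs_of_pos (add_pos hYZ.1 hYZ.2)]
    rcases h with h | h <;> linarith [hYZ.1, hYZ.2]
  · rw [hb.eq_zero (fun h => hYZ ⟨h.1, h.2.1⟩), mul_zero]

lemma IsFlow.continuous_integral_integral (hμ : IsFlow μ) {P : Type*} [TopologicalSpace P]
    {F : P → ℝ → ℝ → ℝ} {τ : P → ℝ} {R R' : ℝ}
    (hF : Continuous fun q : P × ℝ × ℝ => F q.1 q.2.1 q.2.2) (hτ : Continuous τ)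
    (hs : ∀ p Y Z, R < |Y| → F p Y Z = 0) (hs' : ∀ p Y Z, R' < |Z| → F p Y Z = 0) :
    (Continuous fun q : P × ℝ => ∫ Z, F q.1 q.2 Z ∂μ (τ q.1)) ∧
    Continuous fun p => ∫ Y, ∫ Z, F p Y Z ∂μ (τ p) ∂μ (τ p) := by
  have h : Continuous fun q : P × ℝ => ∫ Z, F q.1 q.2 Z ∂μ (τ q.1) :=
    hμ.continuous_integral (F := fun (q : P × ℝ) Z => F q.1 q.2 Z) (τ := fun q => τ q.1)
      (hF.comp (by fun_prop : Continuous fun r : (P × ℝ) × ℝ => (r.1.1, r.1.2, r.2)))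
      (by fun_prop) (fun q => ⟨R', .of_forall fun q Z hZ => hs' q.1 q.2 Z hZ⟩)
  refine ⟨h, hμ.continuous_integral (F := fun p Y => ∫ Z, F p Y Z ∂μ (τ p)) h hτ fun p =>
    ⟨R, .of_forall fun q Y hY => ?_⟩⟩
  simp [hs q Y _ hY]

lemma IsFlow.continuous_gain (hμ : IsFlow μ) (hb : IsRate b c C₀ σ) {P : Type*}
    [TopologicalSpace P] {ψ : P → ℝ → ℝ} {τ : P → ℝ} {R : ℝ}
    (hψ : Continuous fun q : P × ℝ => ψ q.1 q.2) (hτ : Continuous τ)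
    (hs : ∀ p x, R < |x| → ψ p x = 0) :
    Continuous fun p => gain b μ (ψ p) (τ p) := by
  refine (hμ.continuous_integral_integral (R := R) (R' := R)
    (F := fun p Y Z => ψ p (Y + Z) * b (τ p) Y Z) ?_ hτ ?_ ?_).2
  · exact (hψ.comp (by fun_prop : Continuous fun q : P × ℝ × ℝ => (q.1, q.2.1 + q.2.2))).mul
      (hb.comp_continuous (by fun_prop) (by fun_prop) (by fun_prop))
  · exact fun p Y Z hY => hb.gain_integrand_eq_zero (hs p) (.inl hY)
  · exact fun p Y Z hZ => hb.gain_integrand_eq_zero (hs p) (.inr hZ)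

lemma IsFlow.integral_integral_sub (hμ : IsFlow μ) {F G : ℝ → ℝ → ℝ} {R R' : ℝ} (s : ℝ)
    (hF : Continuous fun q : ℝ × ℝ => F q.1 q.2) (hG : Continuous fun q : ℝ × ℝ => G q.1 q.2)
    (hFs : ∀ Y Z, R < |Y| → F Y Z = 0) (hFs' : ∀ Y Z, R' < |Z| → F Y Z = 0)
    (hGs : ∀ Y Z, R < |Y| → G Y Z = 0) (hGs' : ∀ Y Z, R' < |Z| → G Y Z = 0) :
    ∫ Y, ∫ Z, (F Y Z - G Y Z) ∂μ s ∂μ s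
      = (∫ Y, ∫ Z, F Y Z ∂μ s ∂μ s) - ∫ Y, ∫ Z, G Y Z ∂μ s ∂μ s := by
  have := hμ.locallyFinite
  have key : ∀ F : ℝ → ℝ → ℝ, (Continuous fun q : ℝ × ℝ => F q.1 q.2) →
      (∀ Y Z, R < |Y| → F Y Z = 0) → (∀ Y Z, R' < |Z| → F Y Z = 0) →
      Integrable (fun Y => ∫ Z, F Y Z ∂μ s) (μ s) := by
    intro F hF hs hs'
    refine integrable_of_abs (R := R) ?_ (fun Y hY => by simp [hs Y _ hY])
    exact hμ.continuous_integral (F := F) (τ := fun _ => s) hF continuous_const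
      fun p => ⟨R', .of_forall fun q Z hZ => hs' q Z hZ⟩
  rw [← integral_sub (key F hF hFs hFs') (key G hG hGs hGs')]
  congr 1 with Y
  refine integral_sub (integrable_of_abs (R := R') ?_ (hFs' Y)) (integrable_of_abs (R := R') ?_ (hGs' Y))
  · exact hF.comp (by fun_prop : Continuous fun Z : ℝ => (Y, Z))
  · exact hG.comp (by fun_prop : Continuous fun Z : ℝ => (Y, Z))

lemma IsFlow.gain_sub (hμ : IsFlow μ) (hb : IsRate b c C₀ σ) {ψ χ : ℝ → ℝ} {R : ℝ}
    (hψ : Continuous ψ) (hχ : Continuous χ) (hs : ∀ x, R < |x| → ψ x = 0)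
    (hs' : ∀ x, R < |x| → χ x = 0) (s : ℝ) :
    gain b μ (fun x => ψ x - χ x) s = gain b μ ψ s - gain b μ χ s := by
  simp only [gain, sub_mul]
  have hc : Continuous fun q : ℝ × ℝ => b s q.1 q.2 :=
    hb.comp_continuous (by fun_prop) (by fun_prop) (by fun_prop)
  exact hμ.integral_integral_sub (R := R) (R' := R) s (by fun_prop) (by fun_prop)
    (fun Y Z h => hb.gain_integrand_eq_zero hs (.inl h))
    (fun Y Z h => hb.gain_integrand_eq_zero hs (.inr h))
    (fun Y Z h => hb.gain_integrand_eq_zero hs' (.inl h))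
    (fun Y Z h => hb.gain_integrand_eq_zero hs' (.inr h))

lemma IsFlow.gain_intervalIntegral (hμ : IsFlow μ) (hb : IsRate b c C₀ σ) {ψ : ℝ → ℝ → ℝ} {R : ℝ}
    (hψ : Continuous fun q : ℝ × ℝ => ψ q.1 q.2) (hs : ∀ r x, R < |x| → ψ r x = 0) (u s t : ℝ) :
    gain b μ (fun x => ∫ r in s..t, ψ r x) u = ∫ r in s..t, gain b μ (ψ r) u := by
  have := hμ.locallyFinite
  have hF : Continuous fun q : ℝ × ℝ × ℝ => ψ q.1 (q.2.1 + q.2.2) * b u q.2.1 q.2.2 :=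
    (hψ.comp (by fun_prop : Continuous fun q : ℝ × ℝ × ℝ => (q.1, q.2.1 + q.2.2))).mul
      (hb.comp_continuous (by fun_prop) (by fun_prop) (by fun_prop))
  simp only [gain, ← intervalIntegral.integral_mul_const]
  rw [← integral_intervalIntegral_swap (R := R) (G := fun r Y => ∫ Z, ψ r (Y + Z) * b u Y Z ∂μ u)]
  · congr 1 with Y
    refine integral_intervalIntegral_swap (R := R) (G := fun r Z => ψ r (Y + Z) * b u Y Z) ?_ ?_ s t
    · exact hF.comp (by fun_prop : Continuous fun q : ℝ × ℝ => (q.1, Y, q.2))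
    · exact fun r Z hZ => hb.gain_integrand_eq_zero (hs r) (.inr hZ)
  · exact (hμ.continuous_integral_integral (R := R) (R' := R) (τ := fun _ => u) hF continuous_const
      (fun p Y Z hY => hb.gain_integrand_eq_zero (hs p) (.inl hY))
      (fun p Y Z hZ => hb.gain_integrand_eq_zero (hs p) (.inr hZ))).1
  · intro r Y hY
    simp [hb.gain_integrand_eq_zero (hs r) (s := u) (.inl hY)]

/-- A mild solution satisfies the weak (integrated) form of the equation. -/
lemma IsMildFlow.gain_sub_loss (hm : IsMildFlow b κ T μ) (hμ : IsFlow μ) (hb : IsRate b c C₀ σ)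
    {t : ℝ} (ht : t ∈ Icc 0 T) {φ : ℝ → ℝ} (hφ : Continuous φ) (hφc : HasCompactSupport φ) :
    ∫ x, φ x ∂μ t = (∫ x, φ x ∂μ 0)
      + ∫ s in 0..t, (gain b μ φ s - ∫ x, φ x * lossRate b κ μ x s ∂μ s) := by
  have := hμ.locallyFinite
  obtain ⟨R, -, hR⟩ := exists_abs_of_hasCompactSupport hφc
  set A := lossRate b κ μ with hAdef
  have hA : Continuous fun p : ℝ × ℝ => A p.1 p.2 := hμ.continuous_lossRate hb κ
  have hD := continuous_damp hA
  have hφA : Continuous fun p : ℝ × ℝ => φ p.2 * A p.2 p.1 := 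
    (hφ.comp continuous_snd).mul (hA.comp continuous_swap)
  have hG : Continuous fun p : (ℝ × ℝ) × ℝ => φ p.2 * A p.2 p.1.2 * damp A p.2 p.1.1 p.1.2 :=
    (hφA.comp (by fun_prop : Continuous fun p : (ℝ × ℝ) × ℝ => (p.1.2, p.2))).mul
      (hD.comp (by fun_prop : Continuous fun p : (ℝ × ℝ) × ℝ => (p.2, p.1.1, p.1.2)))
  have hGs : ∀ (p : ℝ × ℝ) x, R < |x| → φ x * A x p.2 * damp A x p.1 p.2 = 0 :=
    fun p x hx => by simp [hR x hx]
  have hexp : ∀ s x, φ x * damp A x s t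
      = φ x - ∫ r in s..t, φ x * A x r * damp A x s r := by
    intro s x
    rw [damp_eq_one_sub hA]
    simp only [mul_assoc, intervalIntegral.integral_const_mul]
    ring
  have hGsec : ∀ s, Continuous fun q : ℝ × ℝ => φ q.2 * A q.2 q.1 * damp A q.2 s q.1 :=
    fun s => hG.comp (by fun_prop : Continuous fun q : ℝ × ℝ => ((s, q.1), q.2))
  have hGint : ∀ s, Continuous fun x => ∫ r in s..t, φ x * A x r * damp A x s r := by
    intro s
    refine intervalIntegral.continuous_parametric_intervalIntegral_of_continuous'
      (f := fun x r => φ x * A x r * damp A x s r) ?_ s t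
    exact (hGsec s).comp continuous_swap
  have hGints : ∀ s x, R < |x| → ∫ r in s..t, φ x * A x r * damp A x s r = 0 :=
    fun s x hx => by simp [hR x hx]
  have hL : Continuous fun r => ∫ x, φ x * A x r * damp A x 0 r ∂μ 0 :=
    hμ.continuous_integral (τ := fun _ => 0) (hGsec 0) continuous_const
      fun p => ⟨R, .of_forall fun r x hx => hGs (0, r) x hx⟩
  have hQ : Continuous fun p : ℝ × ℝ =>
      gain b μ (fun x => φ x * A x p.2 * damp A x p.1 p.2) p.1 :=
    hμ.continuous_gain hb hG continuous_fst hGs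
  have hq0 : Continuous fun s => gain b μ φ s :=
    hμ.continuous_gain hb (hφ.comp continuous_snd) continuous_id fun _ => hR
  have hloss : Continuous fun s => ∫ x, φ x * A x s ∂μ s :=
    hμ.continuous_integral hφA continuous_id
      fun p => ⟨R, .of_forall fun s x hx => by simp [hR x hx]⟩
  have hQint : Continuous fun s => ∫ r in s..t,
      gain b μ (fun x => φ x * A x r * damp A x s r) s := by
    have h1 : Continuous fun s => ∫ r in t..s,
        gain b μ (fun x => φ x * A x r * damp A x s r) s :=
      intervalIntegral.continuous_parametric_intervalIntegral_of_continuous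
      (f := fun s r => gain b μ (fun x => φ x * A x r * damp A x s r) s) hQ continuous_id
    simp only [intervalIntegral.integral_symm t]
    exact h1.neg
  have h1 : ∫ x, φ x * damp A x 0 t ∂μ 0
      = (∫ x, φ x ∂μ 0) - ∫ r in 0..t, ∫ x, φ x * A x r * damp A x 0 r ∂μ 0 := by
    simp only [hexp]
    rw [integral_sub (integrable_of_abs hφ hR) (integrable_of_abs (hGint 0) (hGints 0)),
      integral_intervalIntegral_swap (R := R)
        (G := fun r x => φ x * A x r * damp A x 0 r) (hGsec 0) (fun r => hGs (0, r))]
  have h2 : ∀ s, gain b μ (fun x => φ x * damp A x s t) s = gain b μ φ s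
      - ∫ r in s..t, gain b μ (fun x => φ x * A x r * damp A x s r) s := by
    intro s
    simp only [hexp]
    rw [hμ.gain_sub hb hφ (hGint s) hR (hGints s),
      hμ.gain_intervalIntegral hb (hGsec s) (fun r => hGs (s, r))]
  have h3 : ∀ r ∈ Icc 0 t, ∫ x, φ x * A x r ∂μ r
      = (∫ x, φ x * A x r * damp A x 0 r ∂μ 0)
        + ∫ s in 0..r, gain b μ (fun x => φ x * A x r * damp A x s r) s := fun r hr =>
    hm r ⟨hr.1, hr.2.trans ht.2⟩ (fun x => φ x * A x r)
      (hφA.comp (by fun_prop : Continuous fun x : ℝ => (r, x)))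
      (hasCompactSupport_of_abs (R := R) fun x hx => by simp [hR x hx])
  have hQ' : Continuous fun r => ∫ s in 0..r,
      gain b μ (fun x => φ x * A x r * damp A x s r) s :=
    intervalIntegral.continuous_parametric_intervalIntegral_of_continuous
      (f := fun r s => gain b μ (fun x => φ x * A x r * damp A x s r) s)
      (hQ.comp continuous_swap) continuous_id
  rw [hm t ht φ hφ hφc, h1, intervalIntegral.integral_congr (fun s _ => h2 s),
    intervalIntegral.integral_sub (hq0.intervalIntegrable _ _) (hQint.intervalIntegrable _ _),
    intervalIntegral_triangle_swap
      (G := fun s r => gain b μ (fun x => φ x * A x r * damp A x s r) s) hQ ht.1,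
    intervalIntegral.integral_sub (hq0.intervalIntegrable _ _) (hloss.intervalIntegrable _ _),
    intervalIntegral.integral_congr (g := fun r => (∫ x, φ x * A x r * damp A x 0 r ∂μ 0)
        + ∫ s in 0..r, gain b μ (fun x => φ x * A x r * damp A x s r) s)
      (fun r hr => h3 r (by rwa [uIcc_of_le ht.1] at hr)),
    intervalIntegral.integral_add (hL.intervalIntegrable _ _) (hQ'.intervalIntegrable _ _)]
  ring

/-- The integrand of the weak formulation. -/
def transfer (b : ℝ → ℝ → ℝ → ℝ) (φ : ℝ → ℝ) (s Y Z : ℝ) : ℝ :=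
  b s Y Z * (φ (Y + Z) - φ Y)

lemma IsRate.continuous_transfer (hb : IsRate b c C₀ σ) {φ : ℝ → ℝ} (hφ : Continuous φ) :
    Continuous fun p : ℝ × ℝ × ℝ => transfer b φ p.1 p.2.1 p.2.2 :=
  hb.continuous.mul (by fun_prop)

lemma IsRate.mul_right_eq_zero (hb : IsRate b c C₀ σ) {φ : ℝ → ℝ} {R s : ℝ}
    (hR : ∀ x, R < |x| → φ x = 0) {Y Z : ℝ} (h : R < |Y| ∨ c * R < |Z|) :
    φ Y * b s Y Z = 0 := by
  by_cases hY : R < |Y|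
  · rw [hR Y hY, zero_mul]
  · rw [hb.eq_zero, mul_zero]
    rintro ⟨h1, h2, h3, -⟩
    rw [abs_of_pos h1] at hY
    have h4 := h.resolve_left (by rwa [abs_of_pos h1])
    rw [abs_of_pos h2] at h4
    have := hb.one_le
    nlinarith

lemma IsRate.transfer_eq_zero (hb : IsRate b c C₀ σ) {φ : ℝ → ℝ} {R s : ℝ} (hR0 : 0 ≤ R)
    (hR : ∀ x, R < |x| → φ x = 0) {Y Z : ℝ} (h : R < |Y| ∨ c * R < |Z|) :
    transfer b φ s Y Z = 0 := by
  have h1 := hb.mul_right_eq_zero (s := s) hR h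
  have h2 := hb.gain_integrand_eq_zero (s := s) hR (Y := Y) (Z := Z)
    (h.imp id fun h => lt_of_le_of_lt (le_mul_of_one_le_left hR0 hb.one_le) h)
  rw [transfer, mul_sub, mul_comm, h2, mul_comm, h1, sub_zero]

lemma IsMildFlow.weak_form (hm : IsMildFlow b κ T μ) (hμ : IsFlow μ) (hb : IsRate b c C₀ σ)
    {t : ℝ} (ht : t ∈ Icc 0 T) {φ : ℝ → ℝ} (hφ : Continuous φ) {R : ℝ} (hR0 : 0 ≤ R)
    (hR : ∀ x, R < |x| → φ x = 0) :
    ∫ x, φ x ∂μ t = (∫ x, φ x ∂μ 0)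
      + ∫ s in 0..t, (κ * (∫ x, φ x ∂μ s) + ∫ Y, ∫ Z, transfer b φ s Y Z ∂μ s ∂μ s) := by
  have := hμ.locallyFinite
  rw [hm.gain_sub_loss hμ hb ht hφ (hasCompactSupport_of_abs hR)]
  congr 1
  refine intervalIntegral.integral_congr fun s _ => ?_
  have hRc : R ≤ c * R := le_mul_of_one_le_left hR0 hb.one_le
  have hbs : Continuous fun q : ℝ × ℝ => b s q.1 q.2 :=
    hb.comp_continuous (by fun_prop) (by fun_prop) (by fun_prop)
  have hs1 : ∀ Y Z, R < |Y| → φ Y * b s Y Z = 0 := fun Y Z h => hb.mul_right_eq_zero hR (.inl h)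
  have hs2 : ∀ Y Z, c * R < |Z| → φ Y * b s Y Z = 0 :=
    fun Y Z h => hb.mul_right_eq_zero hR (.inr h)
  have h1 : ∫ Y, ∫ Z, transfer b φ s Y Z ∂μ s ∂μ s
      = gain b μ φ s - ∫ Y, ∫ Z, φ Y * b s Y Z ∂μ s ∂μ s := by
    rw [gain, ← hμ.integral_integral_sub (R := R) (R' := c * R) s (by fun_prop) (by fun_prop)
      (fun Y Z h => hb.gain_integrand_eq_zero hR (.inl h))
      (fun Y Z h => hb.gain_integrand_eq_zero hR (.inr (hRc.trans_lt h))) hs1 hs2]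
    simp only [transfer, mul_sub, mul_comm]
  have h2 : ∫ x, φ x * lossRate b κ μ x s ∂μ s
      = (∫ Y, ∫ Z, φ Y * b s Y Z ∂μ s ∂μ s) - κ * ∫ x, φ x ∂μ s := by
    simp only [lossRate, mul_sub, ← integral_const_mul]
    rw [integral_sub]
    · simp only [mul_comm κ]
    · refine integrable_of_abs (R := R) ?_ fun Y hY => by simp [hs1 Y _ hY]
      exact (hμ.continuous_integral_integral (τ := fun _ : ℝ => s)
        (F := fun _ Y Z => φ Y * b s Y Z) (by fun_prop) continuous_const
        (fun _ => hs1) (fun _ => hs2)).1.comp (by fun_prop : Continuous fun Y : ℝ => ((0 : ℝ), Y))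
    · exact (integrable_of_abs hφ hR).mul_const κ
  rw [h1, h2]
  ring

/-- A continuous even function equal to `1` on `[-R,R]`, vanishing outside `[-2R,2R]` and
nonincreasing in the absolute value. -/
def tent (R x : ℝ) : ℝ := max 0 (min 1 (2 - |x| / R))

lemma continuous_tent (R : ℝ) : Continuous (tent R) := by unfold tent; fun_prop

lemma tent_nonneg (R x : ℝ) : 0 ≤ tent R x := le_max_left _ _

lemma tent_le_one (R x : ℝ) : tent R x ≤ 1 := max_le zero_le_one (min_le_left _ _)

lemma tent_eq_one {R x : ℝ} (hR : 0 < R) (hx : |x| ≤ R) : tent R x = 1 := by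
  have : |x| / R ≤ 1 := (div_le_one hR).2 hx
  rw [tent, min_eq_left (by linarith), max_eq_right zero_le_one]

lemma tent_eq_zero {R x : ℝ} (hR : 0 < R) (hx : 2 * R < |x|) : tent R x = 0 := by
  have : 2 < |x| / R := (lt_div_iff₀ hR).2 hx
  rw [tent, max_eq_left ((min_le_right _ _).trans (by linarith))]

lemma tent_add_le {R Y Z : ℝ} (hR : 0 < R) (hY : 0 < Y) (hZ : 0 < Z) :
    tent R (Y + Z) ≤ tent R Y := by
  unfold tent
  rw [abs_of_pos hY, abs_of_pos (add_pos hY hZ)]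
  gcongr
  linarith

lemma measureReal_le_integral_tent {ν : Measure ℝ} [IsLocallyFiniteMeasure ν] {R : ℝ}
    (hR : 0 < R) : ν.real (Icc (-R) R) ≤ ∫ x, tent R x ∂ν := by
  have hi : Integrable (tent R) ν := integrable_of_abs (continuous_tent R)
    fun x hx => tent_eq_zero hR hx
  rw [← integral_indicator_one measurableSet_Icc]
  refine integral_mono ((integrable_indicator_iff measurableSet_Icc).2
    (continuous_const.integrableOn_Icc)) hi fun x => ?_
  by_cases hx : x ∈ Icc (-R) R
  · simp [hx, tent_eq_one hR (abs_le.2 hx)]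
  · simp [hx, tent_nonneg]

lemma integral_tent_le_measureReal {ν : Measure ℝ} [IsLocallyFiniteMeasure ν] {R : ℝ}
    (hR : 0 < R) : ∫ x, tent R x ∂ν ≤ ν.real (Icc (-(2 * R)) (2 * R)) := by
  have := abs_integral_le_of_abs (ν := ν) (f := tent R) (R := 2 * R) (B := 1)
    (fun x hx => tent_eq_zero hR hx)
    fun x _ => by rw [abs_of_nonneg (tent_nonneg _ _)]; exact tent_le_one _ _
  rw [one_mul] at this
  exact (le_abs_self _).trans this

lemma IsFlow.continuous_weakRhs (hμ : IsFlow μ) (hb : IsRate b c C₀ σ) {φ : ℝ → ℝ}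
    (hφ : Continuous φ) {R : ℝ} (hR0 : 0 ≤ R) (hR : ∀ x, R < |x| → φ x = 0) :
    Continuous fun s => κ * (∫ x, φ x ∂μ s) + ∫ Y, ∫ Z, transfer b φ s Y Z ∂μ s ∂μ s := by
  refine ((hμ.continuous φ hφ (hasCompactSupport_of_abs hR)).const_mul κ).add ?_
  exact (hμ.continuous_integral_integral (F := fun s Y Z => transfer b φ s Y Z)
    (hb.continuous_transfer hφ) continuous_id
    (fun s Y Z h => hb.transfer_eq_zero hR0 hR (.inl h))
    (fun s Y Z h => hb.transfer_eq_zero hR0 hR (.inr h))).2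

/-- Coagulation moves mass to larger sizes, so local masses grow at most exponentially. -/
lemma IsMildFlow.mass_le (hm : IsMildFlow b κ T μ) (hμ : IsFlow μ) (hb : IsRate b c C₀ σ)
    {t R : ℝ} (ht : t ∈ Icc 0 T) (hR : 0 < R) :
    (μ t).real (Icc (-R) R) ≤ exp (κ * t) * (μ 0).real (Icc (-(2 * R)) (2 * R)) := by
  have := hμ.locallyFinite
  set u : ℝ → ℝ := fun s => ∫ x, tent R x ∂μ s with hu
  set J : ℝ → ℝ := fun s => ∫ Y, ∫ Z, transfer b (tent R) s Y Z ∂μ s ∂μ s with hJ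
  have hf : Continuous fun s => κ * u s + J s :=
    hμ.continuous_weakRhs hb (continuous_tent R) (by positivity) fun x => tent_eq_zero hR
  have hJ0 : ∀ s, J s ≤ 0 := by
    refine fun s => integral_nonpos fun Y => integral_nonpos fun Z => ?_
    by_cases hYZ : b s Y Z = 0
    · simp [transfer, hYZ]
    · obtain ⟨hY, hZ, -⟩ := hb.comparable _ _ _ hYZ
      exact mul_nonpos_of_nonneg_of_nonpos (hb.nonneg _ _ _)
        (sub_nonpos.2 (tent_add_le hR hY hZ))
  set W : ℝ → ℝ := fun s => exp (-(κ * s)) * (u 0 + ∫ r in 0..s, (κ * u r + J r)) with hW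
  have hWu : ∀ s ∈ Icc 0 T, W s = exp (-(κ * s)) * u s := by
    intro s hs
    simp only [hW, hu, hJ]
    rw [hm.weak_form hμ hb hs (continuous_tent R) (R := 2 * R) (by positivity)
      fun x => tent_eq_zero hR]
  have hd : ∀ s, HasDerivAt W (exp (-(κ * s)) * (-κ) * (u 0 + ∫ r in 0..s, (κ * u r + J r))
      + exp (-(κ * s)) * (κ * u s + J s)) s := by
    intro s
    have h1 : HasDerivAt (fun s => exp (-(κ * s))) (exp (-(κ * s)) * (-κ)) s := by
      simpa using ((hasDerivAt_id s).const_mul κ).neg.exp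
    exact h1.mul ((intervalIntegral.integral_hasDerivAt_right (hf.intervalIntegrable _ _)
      (hf.stronglyMeasurableAtFilter _ _) hf.continuousAt).const_add _)
  have hanti : AntitoneOn W (Icc 0 T) := by
    refine antitoneOn_of_deriv_nonpos (convex_Icc 0 T)
      (fun s _ => (hd s).continuousAt.continuousWithinAt)
      (fun s _ => (hd s).differentiableAt.differentiableWithinAt) fun s hs => ?_
    rw [(hd s).deriv]
    have hs' := interior_subset hs
    have h1 := hWu s hs'
    simp only [hW] at h1
    have h2 : exp (-(κ * s)) * (-κ) * (u 0 + ∫ r in 0..s, (κ * u r + J r))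
        + exp (-(κ * s)) * (κ * u s + J s) = exp (-(κ * s)) * J s := by
      linear_combination (-κ) * h1
    rw [h2]
    exact mul_nonpos_of_nonneg_of_nonpos (exp_pos _).le (hJ0 s)
  have h0 : (0 : ℝ) ∈ Icc 0 T := ⟨le_rfl, ht.1.trans ht.2⟩
  have hWt := hanti h0 ht ht.1
  rw [hWu t ht, hWu 0 h0, mul_zero, neg_zero, exp_zero, one_mul, exp_neg,
    inv_mul_le_iff₀ (exp_pos _)] at hWt
  calc (μ t).real (Icc (-R) R) ≤ u t := measureReal_le_integral_tent hR
    _ ≤ exp (κ * t) * u 0 := hWt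
    _ ≤ _ := by gcongr; exact integral_tent_le_measureReal hR

lemma tendsto_integral_sub_of_uniformEquicontinuous {ν : ℕ → Measure ℝ} {ν₀ : Measure ℝ}
    [∀ n, IsLocallyFiniteMeasure (ν n)] [IsLocallyFiniteMeasure ν₀] {φ : ℕ → ℝ → ℝ} {R B M : ℝ}
    (hφ : UniformEquicontinuous φ) (hs : ∀ n x, R < |x| → φ n x = 0) (hB : ∀ n x, |φ n x| ≤ B)
    (hM : ∀ n, (ν n).real (Icc (-R) R) ≤ M)
    (hν : ∀ f : ℝ → ℝ, Continuous f → HasCompactSupport f →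
      Tendsto (fun n => ∫ x, f x ∂ν n) atTop (𝓝 (∫ x, f x ∂ν₀))) :
    Tendsto (fun n => (∫ x, φ n x ∂ν n) - ∫ x, φ n x ∂ν₀) atTop (𝓝 0) := by
  rw [tendsto_iff_ultrafilter]
  intro 𝒰 h𝒰
  have hK : IsCompact (univ.pi fun _ : ℝ => Icc (-B) B) := isCompact_univ_pi fun _ => isCompact_Icc
  obtain ⟨φ₀, -, hφ₀⟩ := hK.ultrafilter_le_nhds' (𝒰.map φ)
    (Ultrafilter.mem_map.2 (Filter.univ_mem' fun n x _ => abs_le.1 (hB n x)))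
  have hlim : Tendsto φ 𝒰 (𝓝 φ₀) := hφ₀
  have hφ₀c : Continuous φ₀ := hlim.continuous_of_equicontinuous hφ.equicontinuous
  have hφ₀s : ∀ x, R < |x| → φ₀ x = 0 := fun x hx =>
    tendsto_nhds_unique (tendsto_pi_nhds.1 hlim x) (by simp [hs _ x hx])
  have hu : TendstoUniformlyOn φ φ₀ 𝒰 (Icc (-R) R) := by
    have := (EquicontinuousOn.tendsto_uniformOnFun_iff_pi (𝔖 := {K : Set ℝ | IsCompact K})
      (fun K hK => hK) (eq_univ_of_forall fun x => ⟨{x}, isCompact_singleton, rfl⟩)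
      (fun K _ => hφ.equicontinuous.equicontinuousOn K) (𝒰 : Filter ℕ) φ₀).2 hlim
    exact UniformOnFun.tendsto_iff_tendstoUniformlyOn.1 this _ isCompact_Icc
  have hφc : ∀ n, Continuous (φ n) := fun n => hφ.equicontinuous.continuous n
  have h1 := tendsto_integral_of_tendstoUniformlyOn (ν := ν) (ν₀ := ν₀) (.of_forall hM)
    (.of_forall hφc) hφ₀c (.of_forall hs) hφ₀s hu
    ((hν φ₀ hφ₀c (hasCompactSupport_of_abs hφ₀s)).mono_left h𝒰)
  have h2 := tendsto_integral_of_tendstoUniformlyOn (ν := fun _ => ν₀) (ν₀ := ν₀)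
    (.of_forall fun _ => le_rfl) (.of_forall hφc) hφ₀c (.of_forall hs) hφ₀s hu tendsto_const_nhds
  simpa using h1.sub h2

lemma uniformEquicontinuous_integral {F : ℕ → ℝ → ℝ → ℝ} {ν : ℕ → Measure ℝ}
    [∀ n, IsLocallyFiniteMeasure (ν n)] {R M : ℝ} (hM : ∀ n, (ν n).real (Icc (-R) R) ≤ M)
    (hF : ∀ ε > 0, ∃ δ > 0, ∀ n x y z, |x - y| < δ → |F n x z - F n y z| < ε)
    (hc : ∀ n x, Continuous (F n x)) (hs : ∀ n x z, R < |z| → F n x z = 0) :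
    UniformEquicontinuous fun n x => ∫ z, F n x z ∂ν n := by
  rw [Metric.uniformEquicontinuous_iff]
  intro ε hε
  obtain ⟨δ, hδ, h⟩ := hF (ε / (|M| + 1)) (by positivity)
  refine ⟨δ, hδ, fun x y hxy n => ?_⟩
  rw [dist_eq, ← integral_sub (integrable_of_abs (hc n x) (hs n x))
    (integrable_of_abs (hc n y) (hs n y))]
  calc |∫ z, F n x z - F n y z ∂ν n| ≤ ε / (|M| + 1) * (ν n).real (Icc (-R) R) :=
        abs_integral_le_of_abs (fun z hz => by rw [hs n x z hz, hs n y z hz, sub_zero])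
          (fun z _ => (h n x y z hxy).le)
    _ ≤ ε / (|M| + 1) * |M| := by gcongr; exact (hM n).trans (le_abs_self _)
    _ < ε / (|M| + 1) * (|M| + 1) := by gcongr; linarith
    _ = ε := by field_simp

lemma UniformEquicontinuous.add_real {φ ψ : ℕ → ℝ → ℝ} (hφ : UniformEquicontinuous φ)
    (hψ : UniformEquicontinuous ψ) : UniformEquicontinuous fun n x => φ n x + ψ n x := by
  rw [Metric.uniformEquicontinuous_iff] at *
  intro ε hε
  obtain ⟨δ, hδ, h⟩ := hφ (ε / 2) (half_pos hε)
  obtain ⟨δ', hδ', h'⟩ := hψ (ε / 2) (half_pos hε)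
  refine ⟨min δ δ', lt_min hδ hδ', fun x y hxy n => ?_⟩
  calc dist (φ n x + ψ n x) (φ n y + ψ n y) ≤ _ := dist_add_add_le _ _ _ _
    _ < ε / 2 + ε / 2 := add_lt_add (h x y (hxy.trans_le (min_le_left _ _)) n)
        (h' x y (hxy.trans_le (min_le_right _ _)) n)
    _ = ε := add_halves ε

lemma UniformEquicontinuous.const_mul_real {φ : ℕ → ℝ → ℝ} (hφ : UniformEquicontinuous φ)
    (κ : ℝ) : UniformEquicontinuous fun n x => κ * φ n x := by
  rw [Metric.uniformEquicontinuous_iff] at *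
  intro ε hε
  obtain ⟨δ, hδ, h⟩ := hφ (ε / (|κ| + 1)) (by positivity)
  refine ⟨δ, hδ, fun x y hxy n => ?_⟩
  rw [dist_eq, ← mul_sub, abs_mul]
  calc |κ| * |φ n x - φ n y| ≤ |κ| * (ε / (|κ| + 1)) := by gcongr; exact (h x y hxy n).le
    _ < (|κ| + 1) * (ε / (|κ| + 1)) := by gcongr; linarith
    _ = ε := by field_simp

lemma IsRate.uniformEquicontinuous_transfer (hb : IsRate b c C₀ σ) {φ : ℕ → ℝ → ℝ} {R B : ℝ}
    (hR0 : 0 < R) (hφ : UniformEquicontinuous φ) (hs : ∀ n x, R < |x| → φ n x = 0)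
    (hB : ∀ n x, |φ n x| ≤ B) (s : ℝ) :
    UniformEquicontinuous fun n (p : ℝ × ℝ) => transfer b (φ n) s p.1 p.2 := by
  have hc0 : 0 < c := one_pos.trans_le hb.one_le
  have hRc : R ≤ c * R := le_mul_of_one_le_left hR0.le hb.one_le
  have hR' : 0 < c * R := by positivity
  set β : ℝ × ℝ → ℝ := fun p => tent (c * R) p.1 * tent (c * R) p.2 * b s p.1 p.2 with hβ
  have hβc : Continuous β :=
    ((((continuous_tent _).comp continuous_fst).mul ((continuous_tent _).comp continuous_snd))).mul
      (hb.comp_continuous (by fun_prop) (by fun_prop) (by fun_prop))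
  have hβs : HasCompactSupport β :=
    hasCompactSupport_uncurry_of_abs (F := fun x y => β (x, y)) (R := 2 * (c * R))
      (R' := 2 * (c * R)) (fun x y hx => by simp [hβ, tent_eq_zero hR' hx])
      (fun x y hy => by simp [hβ, tent_eq_zero hR' hy])
  obtain ⟨D, hD⟩ := hβc.bounded_above_of_compact_support hβs
  have hβu : UniformContinuous β := hβs.uniformContinuous_of_continuous hβc
  have heq : ∀ n (p : ℝ × ℝ), transfer b (φ n) s p.1 p.2
      = β p * (φ n (p.1 + p.2) - φ n p.1) := by
    intro n p
    by_cases hp : |p.1| ≤ c * R ∧ |p.2| ≤ c * R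
    · simp [hβ, transfer, tent_eq_one hR' hp.1, tent_eq_one hR' hp.2]
    · have h0 : transfer b (φ n) s p.1 p.2 = 0 := by
        refine hb.transfer_eq_zero hR0.le (hs n) ?_
        rw [not_and_or, not_le, not_le] at hp
        exact hp.imp hRc.trans_lt id
      rw [h0, hβ]
      rw [transfer] at h0
      linear_combination (-(tent (c * R) p.1 * tent (c * R) p.2)) * h0
  simp only [heq]
  rw [Metric.uniformEquicontinuous_iff] at *
  intro ε hε
  have hB0 : 0 ≤ B := (abs_nonneg _).trans (hB 0 0)
  have hD0 : 0 ≤ D := (norm_nonneg _).trans (hD (0, 0))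
  obtain ⟨δ, hδ, h⟩ := Metric.uniformContinuous_iff.1 hβu (ε / (4 * B + 1)) (by positivity)
  obtain ⟨δ', hδ', h'⟩ := hφ (ε / (4 * (D + 1))) (by positivity)
  refine ⟨min δ (δ' / 2), by positivity, fun p q hpq n => ?_⟩
  have hp1 : dist p.1 q.1 < δ' / 2 := lt_of_le_of_lt
    ((le_max_left _ _).trans_eq Prod.dist_eq.symm) (hpq.trans_le (min_le_right _ _))
  have hp2 : dist p.2 q.2 < δ' / 2 := lt_of_le_of_lt
    ((le_max_right _ _).trans_eq Prod.dist_eq.symm) (hpq.trans_le (min_le_right _ _))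
  have e1 := h (hpq.trans_le (min_le_left _ _))
  have e2 := h' p.1 q.1 (by linarith) n
  have e3 := h' (p.1 + p.2) (q.1 + q.2) ((dist_add_add_le _ _ _ _).trans_lt (by linarith)) n
  rw [dist_eq] at e1 e2 e3 ⊢
  have hsplit : β p * (φ n (p.1 + p.2) - φ n p.1) - β q * (φ n (q.1 + q.2) - φ n q.1)
      = (β p - β q) * (φ n (p.1 + p.2) - φ n p.1)
        + β q * ((φ n (p.1 + p.2) - φ n (q.1 + q.2)) - (φ n p.1 - φ n q.1)) := by ring
  rw [hsplit]
  have f1 : |φ n (p.1 + p.2) - φ n p.1| ≤ 2 * B := by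
    have := abs_sub (φ n (p.1 + p.2)) (φ n p.1)
    linarith [hB n (p.1 + p.2), hB n p.1]
  have f2 : |(φ n (p.1 + p.2) - φ n (q.1 + q.2)) - (φ n p.1 - φ n q.1)|
      ≤ 2 * (ε / (4 * (D + 1))) := by
    have := abs_sub (φ n (p.1 + p.2) - φ n (q.1 + q.2)) (φ n p.1 - φ n q.1)
    linarith
  calc _ ≤ |β p - β q| * |φ n (p.1 + p.2) - φ n p.1|
        + |β q| * |(φ n (p.1 + p.2) - φ n (q.1 + q.2)) - (φ n p.1 - φ n q.1)| := by
        rw [← abs_mul, ← abs_mul]; exact abs_add_le _ _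
    _ ≤ ε / (4 * B + 1) * (2 * B) + D * (2 * (ε / (4 * (D + 1)))) := by
        gcongr
        exact hD q
    _ < ε := by
        have g1 : ε / (4 * B + 1) * (2 * B) < ε / 2 := by
          rw [div_mul_eq_mul_div, div_lt_div_iff₀ (by positivity) (by positivity)]
          nlinarith
        have g2 : D * (2 * (ε / (4 * (D + 1)))) ≤ ε / 2 := by
          rw [mul_div_assoc', mul_div_assoc', div_le_div_iff₀ (by positivity) (by positivity)]
          nlinarith
        linarith

lemma IsRate.const_nonneg (hb : IsRate b c C₀ σ) : 0 ≤ C₀ := by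
  simpa using (mul_nonneg (hb.nonneg 0 0 1) (rpow_nonneg zero_le_one σ)).trans
    (hb.bound 0 0 1 one_pos)

lemma IsRate.abs_transfer_le (hb : IsRate b c C₀ σ) {φ : ℝ → ℝ} {B : ℝ} (hB : ∀ x, |φ x| ≤ B)
    (s Y Z : ℝ) : |transfer b φ s Y Z| ≤ 2 * B * b s Y Z := by
  rw [transfer, abs_mul, abs_of_nonneg (hb.nonneg _ _ _), mul_comm]
  gcongr
  · exact hb.nonneg _ _ _
  · linarith [abs_sub (φ (Y + Z)) (φ Y), hB (Y + Z), hB Y]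

lemma IsRate.le_left (hb : IsRate b c C₀ σ) (hσ : 0 ≤ σ) {s X Z : ℝ} (hX : 0 < X) :
    b s X Z ≤ C₀ / (X / c) ^ σ := by
  have hc : 0 < c := one_pos.trans_le hb.one_le
  by_cases h : b s X Z = 0
  · rw [h]
    exact div_nonneg hb.const_nonneg (by positivity)
  · obtain ⟨-, hZ, -, h4⟩ := hb.comparable _ _ _ h
    rw [le_div_iff₀ (by positivity)]
    refine le_trans (mul_le_mul_of_nonneg_left (rpow_le_rpow (by positivity) ?_ hσ)
      (hb.nonneg _ _ _)) (hb.bound s X Z hZ)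
    rwa [div_le_iff₀' hc]

lemma IsRate.le_right (hb : IsRate b c C₀ σ) (hσ : 0 ≤ σ) {s X Y : ℝ} (hX : 0 < X) :
    b s Y X ≤ C₀ / (X / c) ^ σ := by
  have hc : 0 < c := one_pos.trans_le hb.one_le
  rw [le_div_iff₀ (by positivity)]
  refine le_trans (mul_le_mul_of_nonneg_left (rpow_le_rpow (by positivity) ?_ hσ)
    (hb.nonneg _ _ _)) (hb.bound s Y X hX)
  exact div_le_self hX.le hb.one_le

lemma abs_integral_le_of_scale {ν : Measure ℝ} [IsLocallyFiniteMeasure ν] {f : ℝ → ℝ}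
    {X D M : ℝ} (hc : 0 < c) (hX : 0 < X) (hD : 0 ≤ D)
    (hν : ∀ R, 0 < R → ν.real (Icc (-R) R) ≤ M * R ^ σ) (hs : ∀ z, c * X < |z| → f z = 0)
    (hf : ∀ z, |f z| ≤ D / (X / c) ^ σ) : |∫ z, f z ∂ν| ≤ D * M * (c ^ 2) ^ σ := by
  have hcX : c * X = c ^ 2 * (X / c) := by field_simp
  calc |∫ z, f z ∂ν| ≤ D / (X / c) ^ σ * ν.real (Icc (-(c * X)) (c * X)) :=
        abs_integral_le_of_abs hs fun z _ => hf z
    _ ≤ D / (X / c) ^ σ * (M * (c * X) ^ σ) := by gcongr; exact hν _ (by positivity)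
    _ = D * M * (c ^ 2) ^ σ := by
        rw [hcX, mul_rpow (by positivity) (by positivity)]
        have : (X / c) ^ σ ≠ 0 := (rpow_pos_of_pos (by positivity) _).ne'
        field_simp

lemma IsRate.abs_integral_transfer_left_le (hb : IsRate b c C₀ σ) (hσ : 0 ≤ σ) {ν : Measure ℝ}
    [IsLocallyFiniteMeasure ν] {M B : ℝ} (hM : 0 ≤ M)
    (hν : ∀ R, 0 < R → ν.real (Icc (-R) R) ≤ M * R ^ σ) {φ : ℝ → ℝ} (hB : ∀ x, |φ x| ≤ B)
    (s X : ℝ) : |∫ Z, transfer b φ s X Z ∂ν| ≤ 2 * B * C₀ * M * (c ^ 2) ^ σ := by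
  have hB0 : 0 ≤ B := (abs_nonneg _).trans (hB 0)
  have hC := hb.const_nonneg
  have hc : 0 < c := one_pos.trans_le hb.one_le
  rcases le_or_gt X 0 with hX | hX
  · have : ∀ Z, transfer b φ s X Z = 0 := fun Z => by
      rw [transfer, hb.eq_zero fun h => hX.not_gt h.1, zero_mul]
    simp only [this, integral_zero, abs_zero]
    positivity
  · refine abs_integral_le_of_scale hc hX (by positivity) hν (fun Z hZ => ?_) fun Z => ?_
    · rw [transfer, hb.eq_zero, zero_mul]
      rintro ⟨-, h2, h3, -⟩
      rw [abs_of_pos h2] at hZ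
      exact h3.not_gt hZ
    · rw [mul_div_assoc]
      refine (hb.abs_transfer_le hB s X Z).trans ?_
      gcongr
      exact hb.le_left hσ hX

lemma IsRate.abs_integral_transfer_right_le (hb : IsRate b c C₀ σ) (hσ : 0 ≤ σ) {ν : Measure ℝ}
    [IsLocallyFiniteMeasure ν] {M B : ℝ} (hM : 0 ≤ M)
    (hν : ∀ R, 0 < R → ν.real (Icc (-R) R) ≤ M * R ^ σ) {φ : ℝ → ℝ} (hB : ∀ x, |φ x| ≤ B)
    (s X : ℝ) : |∫ Y, transfer b φ s Y X ∂ν| ≤ 2 * B * C₀ * M * (c ^ 2) ^ σ := by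
  have hB0 : 0 ≤ B := (abs_nonneg _).trans (hB 0)
  have hC := hb.const_nonneg
  have hc : 0 < c := one_pos.trans_le hb.one_le
  rcases le_or_gt X 0 with hX | hX
  · have : ∀ Y, transfer b φ s Y X = 0 := fun Y => by
      rw [transfer, hb.eq_zero fun h => hX.not_gt h.2.1, zero_mul]
    simp only [this, integral_zero, abs_zero]
    positivity
  · refine abs_integral_le_of_scale hc hX (by positivity) hν (fun Y hY => ?_) fun Y => ?_
    · rw [transfer, hb.eq_zero, zero_mul]
      rintro ⟨h1, -, -, h4⟩
      rw [abs_of_pos h1] at hY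
      exact h4.not_gt hY
    · rw [mul_div_assoc]
      refine (hb.abs_transfer_le hB s Y X).trans ?_
      gcongr
      exact hb.le_right hσ hX

/-- The test function obtained by linearizing the right-hand side of the weak formulation
between two measures `ν` and `ν'`. -/
def linearized (b : ℝ → ℝ → ℝ → ℝ) (κ : ℝ) (ν ν' : Measure ℝ) (φ : ℝ → ℝ) (s X : ℝ) : ℝ :=
  κ * φ X + ((∫ Z, transfer b φ s X Z ∂ν) + ∫ Y, transfer b φ s Y X ∂ν')

lemma IsRate.linearized_eq_zero (hb : IsRate b c C₀ σ) {ν ν' : Measure ℝ} {φ : ℝ → ℝ}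
    {R : ℝ} (hR0 : 0 ≤ R) (hs : ∀ x, R < |x| → φ x = 0) {s X : ℝ} (hX : c * R < |X|) :
    linearized b κ ν ν' φ s X = 0 := by
  have hX' : R < |X| := (le_mul_of_one_le_left hR0 hb.one_le).trans_lt hX
  simp [linearized, hs X hX', hb.transfer_eq_zero hR0 hs (.inl hX'),
    hb.transfer_eq_zero hR0 hs (.inr hX)]

lemma uniformEquicontinuous_of_hasCompactSupport {φ : ℝ → ℝ} (hφ : Continuous φ)
    (hφs : HasCompactSupport φ) : UniformEquicontinuous fun _ : ℕ => φ := by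
  rw [Metric.uniformEquicontinuous_iff]
  intro ε hε
  obtain ⟨δ, hδ, h⟩ :=
    Metric.uniformContinuous_iff.1 (hφs.uniformContinuous_of_continuous hφ) ε hε
  exact ⟨δ, hδ, fun x y hxy _ => h hxy⟩

section

variable {M B R : ℝ} {ν : ℕ → Measure ℝ} {ν' : Measure ℝ} [∀ n, IsLocallyFiniteMeasure (ν n)]
  [IsLocallyFiniteMeasure ν'] {φ : ℕ → ℝ → ℝ}

lemma IsRate.uniformEquicontinuous_integral_left (hb : IsRate b c C₀ σ) (hR0 : 0 < R)
    (hφ : UniformEquicontinuous φ) (hs : ∀ n x, R < |x| → φ n x = 0) (hB : ∀ n x, |φ n x| ≤ B)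
    (hν : ∀ n R, 0 < R → (ν n).real (Icc (-R) R) ≤ M * R ^ σ) (s : ℝ) :
    UniformEquicontinuous fun n X => ∫ Z, transfer b (φ n) s X Z ∂ν n := by
  have hc : 0 < c := one_pos.trans_le hb.one_le
  refine uniformEquicontinuous_integral (fun n => hν n (c * R) (by positivity)) ?_
    (fun n X => (hb.continuous_transfer (hφ.equicontinuous.continuous n)).comp
      (continuous_const.prodMk (continuous_const.prodMk continuous_id)))
    fun n X Z hZ => hb.transfer_eq_zero hR0.le (hs n) (.inr hZ)
  intro ε hε
  obtain ⟨δ, hδ, h⟩ := Metric.uniformEquicontinuous_iff.1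
    (hb.uniformEquicontinuous_transfer hR0 hφ hs hB s) ε hε
  refine ⟨δ, hδ, fun n x y z hxy => ?_⟩
  exact h (x, z) (y, z) (by simpa [Prod.dist_eq, dist_eq, hδ] using hxy) n

lemma IsRate.uniformEquicontinuous_integral_right (hb : IsRate b c C₀ σ) (hR0 : 0 < R)
    (hφ : UniformEquicontinuous φ) (hs : ∀ n x, R < |x| → φ n x = 0) (hB : ∀ n x, |φ n x| ≤ B)
    (hν : ∀ n R, 0 < R → (ν n).real (Icc (-R) R) ≤ M * R ^ σ) (s : ℝ) :
    UniformEquicontinuous fun n X => ∫ Y, transfer b (φ n) s Y X ∂ν n := by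
  have hc : 0 < c := one_pos.trans_le hb.one_le
  refine uniformEquicontinuous_integral (fun n => hν n R hR0) ?_
    (fun n X => (hb.continuous_transfer (hφ.equicontinuous.continuous n)).comp
      (continuous_const.prodMk (continuous_id.prodMk continuous_const)))
    fun n X Z hZ => hb.transfer_eq_zero hR0.le (hs n) (.inl hZ)
  intro ε hε
  obtain ⟨δ, hδ, h⟩ := Metric.uniformEquicontinuous_iff.1
    (hb.uniformEquicontinuous_transfer hR0 hφ hs hB s) ε hε
  refine ⟨δ, hδ, fun n x y z hxy => ?_⟩
  exact h (z, x) (z, y) (by simpa [Prod.dist_eq, dist_eq, hδ] using hxy) n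

lemma IsRate.uniformEquicontinuous_linearized (hb : IsRate b c C₀ σ) (hR0 : 0 < R)
    (hφ : UniformEquicontinuous φ) (hs : ∀ n x, R < |x| → φ n x = 0) (hB : ∀ n x, |φ n x| ≤ B)
    (hν : ∀ n R, 0 < R → (ν n).real (Icc (-R) R) ≤ M * R ^ σ)
    (hν' : ∀ R, 0 < R → ν'.real (Icc (-R) R) ≤ M * R ^ σ) (s : ℝ) :
    UniformEquicontinuous fun n => linearized b κ (ν n) ν' (φ n) s :=
  UniformEquicontinuous.add_real (UniformEquicontinuous.const_mul_real hφ κ)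
    (UniformEquicontinuous.add_real (hb.uniformEquicontinuous_integral_left hR0 hφ hs hB hν s)
      (hb.uniformEquicontinuous_integral_right (ν := fun _ => ν') hR0 hφ hs hB
        (fun _ => hν') s))

end

section

variable {M B R : ℝ} {ν ν' : Measure ℝ} [IsLocallyFiniteMeasure ν]
  [IsLocallyFiniteMeasure ν'] {φ : ℝ → ℝ}

lemma IsRate.abs_linearized_le (hb : IsRate b c C₀ σ) (hκ : 0 ≤ κ) (hσ : 0 ≤ σ) (hM : 0 ≤ M)
    (hB : ∀ x, |φ x| ≤ B) (hν : ∀ R, 0 < R → ν.real (Icc (-R) R) ≤ M * R ^ σ)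
    (hν' : ∀ R, 0 < R → ν'.real (Icc (-R) R) ≤ M * R ^ σ) (s X : ℝ) :
    |linearized b κ ν ν' φ s X| ≤ (κ + 4 * C₀ * M * (c ^ 2) ^ σ) * B := by
  have h1 := hb.abs_integral_transfer_left_le hσ hM hν hB s X
  have h2 := hb.abs_integral_transfer_right_le hσ hM hν' hB s X
  have h3 : |κ * φ X| ≤ κ * B := by
    rw [abs_mul, abs_of_nonneg hκ]
    gcongr
    exact hB X
  have h4 := abs_add_le (∫ Z, transfer b φ s X Z ∂ν) (∫ Y, transfer b φ s Y X ∂ν')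
  refine (abs_add_le _ _).trans ?_
  linarith

lemma IsRate.weakRhs_sub (hb : IsRate b c C₀ σ) (hR0 : 0 < R) (hφ : Continuous φ)
    (hs : ∀ x, R < |x| → φ x = 0) (hν : ∀ R, 0 < R → ν.real (Icc (-R) R) ≤ M * R ^ σ)
    (hν' : ∀ R, 0 < R → ν'.real (Icc (-R) R) ≤ M * R ^ σ) (s : ℝ) :
    (κ * (∫ x, φ x ∂ν) + ∫ Y, ∫ Z, transfer b φ s Y Z ∂ν ∂ν)
      - (κ * (∫ x, φ x ∂ν') + ∫ Y, ∫ Z, transfer b φ s Y Z ∂ν' ∂ν')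
      = (∫ X, linearized b κ ν ν' φ s X ∂ν) - ∫ X, linearized b κ ν ν' φ s X ∂ν' := by
  have hφs := hasCompactSupport_of_abs hs
  obtain ⟨B, hB⟩ := hφ.bounded_above_of_compact_support hφs
  have hφu := uniformEquicontinuous_of_hasCompactSupport hφ hφs
  have hl : Continuous fun X => ∫ Z, transfer b φ s X Z ∂ν :=
    (hb.uniformEquicontinuous_integral_left (ν := fun _ => ν) hR0 hφu (fun _ => hs)
      (fun _ => hB) (fun _ => hν) s).equicontinuous.continuous 0
  have hr : Continuous fun X => ∫ Y, transfer b φ s Y X ∂ν' :=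
    (hb.uniformEquicontinuous_integral_right (ν := fun _ => ν') hR0 hφu (fun _ => hs)
      (fun _ => hB) (fun _ => hν') s).equicontinuous.continuous 0
  have hls : ∀ X, R < |X| → ∫ Z, transfer b φ s X Z ∂ν = 0 := fun X hX => by
    simp [hb.transfer_eq_zero hR0.le hs (.inl hX)]
  have hrs : ∀ X, c * R < |X| → ∫ Y, transfer b φ s Y X ∂ν' = 0 := fun X hX => by
    simp [hb.transfer_eq_zero hR0.le hs (.inr hX)]
  have hintegral : ∀ (η : Measure ℝ) [IsLocallyFiniteMeasure η],
      ∫ X, linearized b κ ν ν' φ s X ∂η = κ * (∫ x, φ x ∂η)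
        + ((∫ X, ∫ Z, transfer b φ s X Z ∂ν ∂η) + ∫ X, ∫ Y, transfer b φ s Y X ∂ν' ∂η) := by
    intro η _
    have h1 := integrable_of_abs (ν := η) hl hls
    have h2 := integrable_of_abs (ν := η) hr hrs
    have h3 := (integrable_of_abs (ν := η) hφ hs).const_mul κ
    unfold linearized
    have h12 : Integrable (fun X => (∫ Z, transfer b φ s X Z ∂ν)
        + ∫ Y, transfer b φ s Y X ∂ν') η := h1.add h2
    rw [integral_add h3 h12, integral_add h1 h2, integral_const_mul]
  have hswap : ∀ (η : Measure ℝ) [IsLocallyFiniteMeasure η],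
      ∫ X, ∫ Y, transfer b φ s Y X ∂ν' ∂η = ∫ Y, ∫ X, transfer b φ s Y X ∂η ∂ν' := by
    intro η _
    refine integral_integral_swap_of_hasCompactSupport (f := fun X Y => transfer b φ s Y X) ?_ ?_
    · exact (hb.continuous_transfer hφ).comp
        (continuous_const.prodMk (continuous_snd.prodMk continuous_fst))
    · exact hasCompactSupport_uncurry_of_abs
        (fun X Y hX => hb.transfer_eq_zero hR0.le hs (.inr hX))
        (fun X Y hY => hb.transfer_eq_zero hR0.le hs (.inl hY))
  rw [hintegral ν, hintegral ν', hswap ν, hswap ν']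
  ring

lemma abs_integral_sub_le (hB0 : 0 ≤ B) (hR0 : 0 < R) (hB : ∀ x, |φ x| ≤ B)
    (hs : ∀ x, R < |x| → φ x = 0) (hν : ∀ R, 0 < R → ν.real (Icc (-R) R) ≤ M * R ^ σ)
    (hν' : ∀ R, 0 < R → ν'.real (Icc (-R) R) ≤ M * R ^ σ) :
    |(∫ x, φ x ∂ν) - ∫ x, φ x ∂ν'| ≤ 2 * M * B * R ^ σ := by
  have key : ∀ (η : Measure ℝ) [IsLocallyFiniteMeasure η],
      (∀ R, 0 < R → η.real (Icc (-R) R) ≤ M * R ^ σ) → |∫ x, φ x ∂η| ≤ B * (M * R ^ σ) := by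
    intro η _ hη
    refine (abs_integral_le_of_abs hs fun x _ => hB x).trans ?_
    gcongr
    exact hη R hR0
  linarith [abs_sub (∫ x, φ x ∂ν) (∫ x, φ x ∂ν'), key ν hν, key ν' hν']

end

/-- The bound after `k` steps of the iteration for the difference of two solutions. -/
def iterBound (M L c σ : ℝ) (k : ℕ) (B R t : ℝ) : ℝ :=
  2 * M * B * R ^ σ * (L * c ^ σ * t) ^ k / k.factorial

lemma integral_iterBound {M L B R : ℝ} (hc : 0 ≤ c) (hR : 0 ≤ R) (k : ℕ) (t : ℝ) :
    ∫ s in 0..t, iterBound M L c σ k (L * B) (c * R) s = iterBound M L c σ (k + 1) B R t := by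
  have : ∀ s, iterBound M L c σ k (L * B) (c * R) s
      = 2 * M * B * R ^ σ * (L * c ^ σ) ^ (k + 1) / k.factorial * s ^ k := fun s => by
    rw [iterBound, mul_rpow hc hR, mul_pow (L * c ^ σ) s k]
    ring
  simp only [this]
  rw [intervalIntegral.integral_const_mul, integral_pow, iterBound, Nat.factorial_succ]
  have := k.factorial_pos
  push_cast
  field_simp
  ring

lemma continuous_iterBound {M L B R : ℝ} (k : ℕ) : Continuous (iterBound M L c σ k B R) := by
  unfold iterBound
  fun_prop

section

variable {M : ℝ} {μn : ℕ → ℝ → Measure ℝ}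

lemma tendsto_excess (hb : IsRate b c C₀ σ) (hκ : 0 ≤ κ) (hσ : 0 ≤ σ) (hM : 0 ≤ M)
    (hμn : ∀ n, IsFlow (μn n)) (hμ : IsFlow μ) (hmn : ∀ n, IsMildFlow b κ T (μn n))
    (hm : IsMildFlow b κ T μ)
    (hgn : ∀ n t R, 0 < R → (μn n t).real (Icc (-R) R) ≤ M * R ^ σ)
    (hg : ∀ t R, 0 < R → (μ t).real (Icc (-R) R) ≤ M * R ^ σ)
    (h0 : ∀ f : ℝ → ℝ, Continuous f → HasCompactSupport f →
      Tendsto (fun n => ∫ x, f x ∂μn n 0) atTop (𝓝 (∫ x, f x ∂μ 0))) (k : ℕ) :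
    ∀ (R B : ℝ) (φ : ℕ → ℝ → ℝ), 0 < R → 0 ≤ B → UniformEquicontinuous φ →
      (∀ n x, R < |x| → φ n x = 0) → (∀ n x, |φ n x| ≤ B) → ∀ t ∈ Icc 0 T,
      Tendsto (fun n => max (|(∫ x, φ n x ∂μn n t) - ∫ x, φ n x ∂μ t|
        - iterBound M (κ + 4 * C₀ * M * (c ^ 2) ^ σ) c σ k B R t) 0) atTop (𝓝 0) := by
  have := fun n t => (hμn n).locallyFinite t
  have := hμ.locallyFinite
  have hc : 0 < c := one_pos.trans_le hb.one_le
  have hC := hb.const_nonneg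
  set L := κ + 4 * C₀ * M * (c ^ 2) ^ σ with hL
  have hL0 : 0 ≤ L := by positivity
  induction k with
  | zero =>
    intro R B φ hR hB0 hφ hs hB t ht
    have : ∀ n, max (|(∫ x, φ n x ∂μn n t) - ∫ x, φ n x ∂μ t| - iterBound M L c σ 0 B R t) 0
        = 0 := fun n => by
      rw [max_eq_right]
      simpa [iterBound] using abs_integral_sub_le hB0 hR (hB n) (hs n) (hgn n t) (hg t)
    simp only [this, tendsto_const_nhds]
  | succ k ih =>
    intro R B φ hR hB0 hφ hs hB t ht
    have hφc : ∀ n, Continuous (φ n) := fun n => hφ.equicontinuous.continuous n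
    set ψ : ℝ → ℕ → ℝ → ℝ := fun s n => linearized b κ (μn n s) (μ s) (φ n) s with hψ
    set g : ℕ → ℝ → ℝ := fun n s => (∫ x, ψ s n x ∂μn n s) - ∫ x, ψ s n x ∂μ s with hgdef
    have hψe : ∀ s, UniformEquicontinuous (ψ s) := fun s =>
      hb.uniformEquicontinuous_linearized hR hφ hs hB (fun n => hgn n s) (hg s) s
    have hψB : ∀ s n x, |ψ s n x| ≤ L * B := fun s n x =>
      hb.abs_linearized_le hκ hσ hM (hB n) (hgn n s) (hg s) s x
    have hψs : ∀ s n x, c * R < |x| → ψ s n x = 0 := fun s n x hx =>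
      hb.linearized_eq_zero hR.le (hs n) hx
    have hgeq : ∀ n s, g n s = (κ * (∫ x, φ n x ∂μn n s)
          + ∫ Y, ∫ Z, transfer b (φ n) s Y Z ∂μn n s ∂μn n s)
        - (κ * (∫ x, φ n x ∂μ s) + ∫ Y, ∫ Z, transfer b (φ n) s Y Z ∂μ s ∂μ s) := fun n s =>
      (hb.weakRhs_sub hR (hφc n) (hs n) (hgn n s) (hg s) s).symm
    have hw1 := fun n => (hμn n).continuous_weakRhs (κ := κ) hb (hφc n) hR.le (hs n)
    have hw2 := fun n => hμ.continuous_weakRhs (κ := κ) hb (hφc n) hR.le (hs n)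
    have hgc : ∀ n, Continuous (g n) := fun n => by
      simp only [funext (hgeq n)]
      exact (hw1 n).sub (hw2 n)
    set e : ℕ → ℝ → ℝ := fun n s => max (|g n s| - iterBound M L c σ k (L * B) (c * R) s) 0
      with he
    have hec : ∀ n, Continuous (e n) := fun n =>
      ((hgc n).abs.sub (continuous_iterBound k)).max continuous_const
    have hδ : ∀ n, (∫ x, φ n x ∂μn n t) - ∫ x, φ n x ∂μ t
        = ((∫ x, φ n x ∂μn n 0) - ∫ x, φ n x ∂μ 0) + ∫ s in 0..t, g n s := fun n => by
      rw [(hmn n).weak_form (hμn n) hb ht (hφc n) hR.le (hs n),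
        hm.weak_form hμ hb ht (hφc n) hR.le (hs n)]
      simp only [hgeq]
      rw [intervalIntegral.integral_sub ((hw1 n).intervalIntegrable _ _)
        ((hw2 n).intervalIntegrable _ _)]
      ring
    have hle : ∀ n, |(∫ x, φ n x ∂μn n t) - ∫ x, φ n x ∂μ t|
          - iterBound M L c σ (k + 1) B R t
        ≤ |(∫ x, φ n x ∂μn n 0) - ∫ x, φ n x ∂μ 0| + ∫ s in 0..t, e n s := fun n => by
      have h1 : |∫ s in 0..t, g n s| ≤ ∫ s in 0..t, |g n s| :=
        intervalIntegral.abs_integral_le_integral_abs ht.1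
      have h2 : ∫ s in 0..t, |g n s|
          ≤ ∫ s in 0..t, (iterBound M L c σ k (L * B) (c * R) s + e n s) := by
        refine intervalIntegral.integral_mono_on ht.1 ((hgc n).abs.intervalIntegrable _ _)
          (((continuous_iterBound k).add (hec n)).intervalIntegrable _ _) fun s _ => ?_
        linarith [le_max_left (|g n s| - iterBound M L c σ k (L * B) (c * R) s) 0]
      rw [intervalIntegral.integral_add ((continuous_iterBound k).intervalIntegrable _ _)
        ((hec n).intervalIntegrable _ _), integral_iterBound hc.le hR.le] at h2
      rw [hδ n]
      linarith [abs_add_le ((∫ x, φ n x ∂μn n 0) - ∫ x, φ n x ∂μ 0) (∫ s in 0..t, g n s)]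
    have hinit : Tendsto (fun n => |(∫ x, φ n x ∂μn n 0) - ∫ x, φ n x ∂μ 0|) atTop (𝓝 0) := by
      simpa using (tendsto_integral_sub_of_uniformEquicontinuous hφ hs hB
        (fun n => hgn n 0 R hR) h0).abs
    have hintegral : Tendsto (fun n => ∫ s in 0..t, e n s) atTop (𝓝 0) := by
      have h := intervalIntegral.tendsto_integral_filter_of_dominated_convergence
        (μ := volume) (a := 0) (b := t) (l := atTop) (F := e) (f := fun _ => (0 : ℝ))
        (fun _ => 2 * M * (L * B) * (c * R) ^ σ)
        (.of_forall fun n => (hec n).aestronglyMeasurable)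
        (.of_forall fun n => .of_forall fun s hs' => ?_) (by simp)
        (.of_forall fun s hs' => ?_)
      · simpa using h
      · rw [uIoc_of_le ht.1] at hs'
        have h1 : |g n s| ≤ 2 * M * (L * B) * (c * R) ^ σ :=
          abs_integral_sub_le (by positivity) (by positivity) (hψB s n) (hψs s n) (hgn n s) (hg s)
        have hs0 := hs'.1.le
        have h2 : 0 ≤ iterBound M L c σ k (L * B) (c * R) s := by
          unfold iterBound
          positivity
        rw [norm_eq_abs, abs_of_nonneg (le_max_right _ _)]
        exact max_le (by linarith) (by positivity)
      · rw [uIoc_of_le ht.1] at hs'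
        exact ih (c * R) (L * B) (ψ s) (by positivity) (by positivity) (hψe s) (hψs s) (hψB s) s
          ⟨hs'.1.le, hs'.2.trans ht.2⟩
    refine squeeze_zero (fun n => le_max_right _ _) (fun n => max_le (hle n) ?_)
      (by simpa using hinit.add hintegral)
    exact add_nonneg (abs_nonneg _)
      (intervalIntegral.integral_nonneg ht.1 fun s _ => le_max_right _ _)

/-- Stability of mild flows with respect to weak convergence of the initial data. -/
theorem tendsto_integral_of_isMildFlow (hb : IsRate b c C₀ σ) (hκ : 0 ≤ κ) (hσ : 0 ≤ σ)
    (hM : 0 ≤ M) (hμn : ∀ n, IsFlow (μn n)) (hμ : IsFlow μ)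
    (hmn : ∀ n, IsMildFlow b κ T (μn n)) (hm : IsMildFlow b κ T μ)
    (hgn : ∀ n t R, 0 < R → (μn n t).real (Icc (-R) R) ≤ M * R ^ σ)
    (hg : ∀ t R, 0 < R → (μ t).real (Icc (-R) R) ≤ M * R ^ σ)
    (h0 : ∀ f : ℝ → ℝ, Continuous f → HasCompactSupport f →
      Tendsto (fun n => ∫ x, f x ∂μn n 0) atTop (𝓝 (∫ x, f x ∂μ 0))) {t : ℝ} (ht : t ∈ Icc 0 T)
    {f : ℝ → ℝ} (hf : Continuous f) (hfs : HasCompactSupport f) :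
    Tendsto (fun n => ∫ x, f x ∂μn n t) atTop (𝓝 (∫ x, f x ∂μ t)) := by
  obtain ⟨R, hR, hs⟩ := exists_abs_of_hasCompactSupport hfs
  obtain ⟨B, hB⟩ := hf.bounded_above_of_compact_support hfs
  have hB0 : 0 ≤ B := (norm_nonneg _).trans (hB 0)
  have hφu := uniformEquicontinuous_of_hasCompactSupport hf hfs
  rw [Metric.tendsto_atTop]
  intro ε hε
  set L := κ + 4 * C₀ * M * (c ^ 2) ^ σ
  have hk : Tendsto (fun k => iterBound M L c σ k B R t) atTop (𝓝 0) := by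
    simpa [iterBound, mul_div_assoc] using
      (FloorSemiring.tendsto_pow_div_factorial_atTop (L * c ^ σ * t)).const_mul
        (2 * M * B * R ^ σ)
  obtain ⟨k, hk⟩ := (hk.eventually_lt_const (half_pos hε)).exists
  have hex := tendsto_excess hb hκ hσ hM hμn hμ hmn hm hgn hg h0 k R B (fun _ => f) hR hB0 hφu
    (fun _ => hs) (fun _ => hB) t ht
  obtain ⟨N, hN⟩ := eventually_atTop.1 (hex.eventually_lt_const (half_pos hε))
  refine ⟨N, fun n hn => ?_⟩
  have := (le_max_left _ _).trans_lt (hN n hn)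
  rw [dist_eq]
  linarith

end

end

lemma CutoffHyp.continuous {ζ : ℝ → ℝ} (hζ : CutoffHyp ζ) : Continuous ζ := by
  have h : ζ = fun s => ζ (max s 0) := by
    ext s
    rcases le_total s 0 with hs | hs
    · rw [max_eq_right hs, hζ.zero s (by linarith), hζ.zero 0 (by norm_num)]
    · rw [max_eq_left hs]
  rw [h]
  exact hζ.smooth.continuousOn.comp_continuous (by fun_prop) fun s => mem_Ici.2 (le_max_right _ _)

lemma CutoffHyp.nonneg {ζ : ℝ → ℝ} (hζ : CutoffHyp ζ) (s : ℝ) : 0 ≤ ζ s := by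
  rcases le_total s (1 / 2) with hs | hs
  · exact (hζ.zero s hs).ge
  · rw [← hζ.zero (1 / 2) le_rfl]
    exact hζ.mono (mem_Ici.2 (by norm_num)) (mem_Ici.2 (by linarith)) hs

lemma CutoffHyp.le_one {ζ : ℝ → ℝ} (hζ : CutoffHyp ζ) (s : ℝ) : ζ s ≤ 1 := by
  rcases le_total s (1 / 2) with hs | hs
  · rw [hζ.zero s hs]
    exact zero_le_one
  · rw [← hζ.one (max s 1) (le_max_right _ _)]
    exact hζ.mono (mem_Ici.2 (by linarith)) (mem_Ici.2 (zero_le_one.trans (le_max_right _ _)))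
      (le_max_left _ _)

section

variable {K : ℝ → ℝ → ℝ} {ζ : ℝ → ℝ} {γ C lam : ℝ}

lemma Kreg_eq_zero (hζ : CutoffHyp ζ) (hl : 0 < lam) {y z : ℝ} (h : y ≤ lam / 2 ∨ z ≤ lam / 2) :
    Kreg K ζ lam y z = 0 := by
  rcases h with h | h
  · rw [Kreg, hζ.zero (y / lam) (by rw [div_le_iff₀ hl]; linarith)]
    ring
  · rw [Kreg, hζ.zero (z / lam) (by rw [div_le_iff₀ hl]; linarith)]
    ring

lemma lt_of_Kreg_ne_zero (hζ : CutoffHyp ζ) (hl : 0 < lam) {y z : ℝ} (h : Kreg K ζ lam y z ≠ 0) :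
    lam / 2 < y ∧ lam / 2 < z := by
  contrapose! h
  refine Kreg_eq_zero hζ hl ?_
  by_contra! h'
  exact (h h'.1).not_gt h'.2

lemma comparable_of_Kreg_ne_zero (hζ : CutoffHyp ζ) (hl : 0 < lam) {y z : ℝ}
    (h : Kreg K ζ lam y z ≠ 0) : z ≤ 2 / lam * y ∧ y ≤ 2 / lam * z := by
  obtain ⟨hy, hz⟩ := lt_of_Kreg_ne_zero hζ hl h
  have hy0 : 0 < y := by linarith
  have hz0 : 0 < z := by linarith
  rw [div_mul_eq_mul_div, div_mul_eq_mul_div, le_div_iff₀ hl, le_div_iff₀ hl]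
  have key : ∀ w, 0 < w → ζ (w / (lam * (y + z))) ≠ 0 → lam * (y + z) < 2 * w := by
    intro w hw hne
    by_contra! hle
    refine hne (hζ.zero _ ?_)
    rw [div_le_iff₀ (by positivity)]
    linarith
  have h1 := key y hy0 (right_ne_zero_of_mul (left_ne_zero_of_mul h))
  have h2 := key z hz0 (right_ne_zero_of_mul h)
  constructor <;> nlinarith

lemma Kreg_nonneg (hK : KernelHyp K γ C) (hζ : CutoffHyp ζ) (hl : 0 < lam) (y z : ℝ) :
    0 ≤ Kreg K ζ lam y z := by
  by_cases h : Kreg K ζ lam y z = 0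
  · exact h.ge
  · obtain ⟨hy, hz⟩ := lt_of_Kreg_ne_zero hζ hl h
    have := hK.nonneg y z (by linarith) (by linarith)
    unfold Kreg
    have h1 := hζ.nonneg (y / lam)
    have h2 := hζ.nonneg (z / lam)
    have h3 := hζ.nonneg (y / (lam * (y + z)))
    have h4 := hζ.nonneg (z / (lam * (y + z)))
    positivity

lemma Kreg_le (hK : KernelHyp K γ C) (hζ : CutoffHyp ζ) {y z : ℝ}
    (hy : 0 < y) (hz : 0 < z) : Kreg K ζ lam y z ≤ C * (y ^ γ + z ^ γ) := by
  have h0 := hK.nonneg y z hy hz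
  refine le_trans ?_ (hK.growth y z hy hz)
  have key : ∀ a s, 0 ≤ a → a * ζ s ≤ a ∧ 0 ≤ a * ζ s := fun a s ha =>
    ⟨mul_le_of_le_one_right ha (hζ.le_one s), mul_nonneg ha (hζ.nonneg s)⟩
  have h1 := key _ (y / lam) h0
  have h2 := key _ (z / lam) h1.2
  have h3 := key _ (y / (lam * (y + z))) h2.2
  have h4 := key _ (z / (lam * (y + z))) h3.2
  exact h4.1.trans (h3.1.trans (h2.1.trans h1.1))

lemma continuous_Kreg (hK : KernelHyp K γ C) (hζ : CutoffHyp ζ) (hl : 0 < lam) :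
    Continuous fun p : ℝ × ℝ => Kreg K ζ lam p.1 p.2 := by
  have hζc := hζ.continuous
  rw [continuous_iff_continuousAt]
  intro p
  by_cases hp : 0 < p.1 ∧ 0 < p.2
  · have hK' : ContinuousAt (fun p : ℝ × ℝ => K p.1 p.2) p :=
      hK.cont.continuousAt ((isOpen_Ioi.prod isOpen_Ioi).mem_nhds hp)
    have hne : lam * (p.1 + p.2) ≠ 0 := (mul_pos hl (add_pos hp.1 hp.2)).ne'
    have h1 : ContinuousAt (fun p : ℝ × ℝ => p.1 / (lam * (p.1 + p.2))) p :=
      ContinuousAt.div (by fun_prop) (by fun_prop) hne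
    have h2 : ContinuousAt (fun p : ℝ × ℝ => p.2 / (lam * (p.1 + p.2))) p :=
      ContinuousAt.div (by fun_prop) (by fun_prop) hne
    exact (((hK'.mul (by fun_prop)).mul (by fun_prop)).mul
      (hζc.continuousAt.comp h1)).mul (hζc.continuousAt.comp h2)
  · have hz : (fun p : ℝ × ℝ => Kreg K ζ lam p.1 p.2) =ᶠ[𝓝 p] fun _ => 0 := by
      rw [not_and_or, not_lt, not_lt] at hp
      rcases hp with hp | hp
      · filter_upwards [continuousAt_fst.eventually_lt_const (hp.trans_lt (half_pos hl))] with q hq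
        exact Kreg_eq_zero hζ hl (.inl hq.le)
      · filter_upwards [continuousAt_snd.eventually_lt_const (hp.trans_lt (half_pos hl))] with q hq
        exact Kreg_eq_zero hζ hl (.inr hq.le)
    exact continuousAt_const.congr hz.symm

/-- The rate `K_λ(Ye^{-βτ(t)}, Ze^{-βτ(t)})/Z` in self-similar variables, with a time change. -/
def rescaledRate (Kl : ℝ → ℝ → ℝ) (β : ℝ) (τ : ℝ → ℝ) (t Y Z : ℝ) : ℝ :=
  Kl (Y * exp (-(β * τ t))) (Z * exp (-(β * τ t))) / Z

lemma isRate_rescaledRate (hK : KernelHyp K γ C) (hC : 0 ≤ C) (hγ : 0 ≤ γ) (hζ : CutoffHyp ζ)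
    (hl : 0 < lam) (hl2 : lam ≤ 2) {ρ β : ℝ} (hρ : γ ≤ ρ) (hβ : 0 ≤ β) {τ : ℝ → ℝ}
    (hτ : Continuous τ) (hτ0 : ∀ t, 0 ≤ τ t) :
    IsRate (rescaledRate (Kreg K ζ lam) β τ) (2 / lam)
      (C * ((2 / lam) ^ γ + 1) * (lam / 2) ^ (γ - ρ)) (1 - ρ) where
  one_le := (one_le_div hl).2 hl2
  continuous := by
    have hnum : Continuous fun p : ℝ × ℝ × ℝ =>
        Kreg K ζ lam (p.2.1 * exp (-(β * τ p.1))) (p.2.2 * exp (-(β * τ p.1))) :=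
      (continuous_Kreg hK hζ hl).comp (f := fun p : ℝ × ℝ × ℝ =>
        (p.2.1 * exp (-(β * τ p.1)), p.2.2 * exp (-(β * τ p.1)))) (by fun_prop)
    rw [continuous_iff_continuousAt]
    intro p
    by_cases hp : p.2.2 = 0
    · have hc : ContinuousAt (fun p : ℝ × ℝ × ℝ => p.2.2 * exp (-(β * τ p.1))) p :=
        Continuous.continuousAt (by fun_prop)
      have hz : (fun p : ℝ × ℝ × ℝ => rescaledRate (Kreg K ζ lam) β τ p.1 p.2.1 p.2.2)
          =ᶠ[𝓝 p] fun _ => 0 := by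
        filter_upwards [hc.eventually_lt_const (u := lam / 2) (by simp [hp, hl])] with q hq
        rw [rescaledRate, Kreg_eq_zero hζ hl (.inr hq.le), zero_div]
      exact continuousAt_const.congr hz.symm
    · exact hnum.continuousAt.div (by fun_prop) hp
  nonneg t Y Z := by
    by_cases h : Kreg K ζ lam (Y * exp (-(β * τ t))) (Z * exp (-(β * τ t))) = 0
    · rw [rescaledRate, h, zero_div]
    · have hZ : 0 < Z :=
        pos_of_mul_pos_left ((half_pos hl).trans (lt_of_Kreg_ne_zero hζ hl h).2) (exp_pos _).le
      exact div_nonneg (Kreg_nonneg hK hζ hl _ _) hZ.le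
  comparable t Y Z h := by
    have h' : Kreg K ζ lam (Y * exp (-(β * τ t))) (Z * exp (-(β * τ t))) ≠ 0 := fun h0 =>
      h (by rw [rescaledRate, h0, zero_div])
    have he := exp_pos (-(β * τ t))
    obtain ⟨h1, h2⟩ := lt_of_Kreg_ne_zero hζ hl h'
    obtain ⟨h3, h4⟩ := comparable_of_Kreg_ne_zero hζ hl h'
    rw [← mul_assoc] at h3 h4
    exact ⟨pos_of_mul_pos_left ((half_pos hl).trans h1) he.le,
      pos_of_mul_pos_left ((half_pos hl).trans h2) he.le,
      le_of_mul_le_mul_right h3 he, le_of_mul_le_mul_right h4 he⟩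
  bound t Y Z hZ := by
    set e := exp (-(β * τ t)) with he
    have he0 : 0 < e := exp_pos _
    have he1 : e ≤ 1 := exp_le_one_iff.2 (neg_nonpos.2 (mul_nonneg hβ (hτ0 t)))
    by_cases h : Kreg K ζ lam (Y * e) (Z * e) = 0
    · rw [rescaledRate, ← he, h, zero_div, zero_mul]
      positivity
    obtain ⟨h1, h2⟩ := lt_of_Kreg_ne_zero hζ hl h
    obtain ⟨-, h4⟩ := comparable_of_Kreg_ne_zero hζ hl h
    have hy : 0 < Y * e := (half_pos hl).trans h1
    have hz : 0 < Z * e := (half_pos hl).trans h2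
    have hzZ : Z * e ≤ Z := mul_le_of_le_one_right hZ.le he1
    have hKle : Kreg K ζ lam (Y * e) (Z * e) ≤ C * ((2 / lam) ^ γ + 1) * Z ^ γ := by
      refine (Kreg_le hK hζ hy hz).trans ?_
      rw [mul_assoc, add_mul, one_mul, ← mul_rpow (by positivity) hZ.le]
      exact mul_le_mul_of_nonneg_left (add_le_add
        (rpow_le_rpow hy.le (h4.trans (by gcongr)) hγ) (rpow_le_rpow hz.le hzZ hγ)) hC
    calc rescaledRate (Kreg K ζ lam) β τ t Y Z * Z ^ (1 - ρ)
        = Kreg K ζ lam (Y * e) (Z * e) * Z ^ (-ρ) := by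
          rw [rescaledRate, ← he, sub_eq_add_neg, rpow_add hZ, rpow_one]
          field_simp
      _ ≤ C * ((2 / lam) ^ γ + 1) * Z ^ γ * Z ^ (-ρ) := by gcongr
      _ = C * ((2 / lam) ^ γ + 1) * Z ^ (γ - ρ) := by
          rw [mul_assoc, ← rpow_add hZ, sub_eq_add_neg]
      _ ≤ C * ((2 / lam) ^ γ + 1) * (lam / 2) ^ (γ - ρ) := by
          have := rpow_le_rpow_of_nonpos (half_pos hl) (h2.le.trans hzZ) (sub_nonpos.2 hρ)
          gcongr

end

lemma MemX.measure_Icc_le {ρ : ℝ} {ν : Measure ℝ} (h : MemX ρ ν) (R : ℝ) :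
    ν (Icc (-R) R) ≤ ν (Icc 0 R) := by
  have hsub : Icc (-R) R ⊆ Iio 0 ∪ Icc 0 R := fun x hx => by
    rcases lt_or_ge x 0 with h0 | h0
    · exact .inl h0
    · exact .inr ⟨h0, hx.2⟩
  calc ν (Icc (-R) R) ≤ ν (Iio 0) + ν (Icc 0 R) := (measure_mono hsub).trans (measure_union_le _ _)
    _ = ν (Icc 0 R) := by rw [h.1, zero_add]

lemma MemX.isLocallyFiniteMeasure {ρ : ℝ} {ν : Measure ℝ} (h : MemX ρ ν) :
    IsLocallyFiniteMeasure ν := by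
  refine ⟨fun x => ⟨Icc (-(|x| + 1)) (|x| + 1), ?_, ?_⟩⟩
  · exact Icc_mem_nhds (by linarith [neg_abs_le x]) (by linarith [le_abs_self x])
  · obtain ⟨M, hM⟩ := h.2
    exact (h.measure_Icc_le _).trans_lt ((hM _ (by positivity)).trans_lt ENNReal.ofReal_lt_top)

lemma MemX.measureReal_le {ρ M : ℝ} {ν : Measure ℝ} (h : MemX ρ ν) (hM0 : 0 ≤ M)
    (hM : ∀ R > (0 : ℝ), ν (Icc 0 R) ≤ ENNReal.ofReal (M * R ^ (1 - ρ))) {R : ℝ} (hR : 0 < R) :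
    ν.real (Icc (-R) R) ≤ M * R ^ (1 - ρ) :=
  ENNReal.toReal_le_of_le_ofReal (by positivity) ((h.measure_Icc_le R).trans (hM R hR))

lemma MemX.exists_measureReal_le {ρ : ℝ} {ν : Measure ℝ} (h : MemX ρ ν) :
    ∃ M, 0 ≤ M ∧ ∀ R, 0 < R → ν.real (Icc (-R) R) ≤ M * R ^ (1 - ρ) := by
  obtain ⟨M, hM⟩ := h.2
  refine ⟨max M 0, le_max_right _ _, fun R hR =>
    h.measureReal_le (le_max_right _ _) (fun R hR => (hM R hR).trans ?_) hR⟩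
  gcongr
  exact le_max_left _ _

lemma MemX.measureReal_le_of_Xnorm_lt {ρ M : ℝ} {ν : Measure ℝ} (h : MemX ρ ν)
    (hM : Xnorm ρ ν < M) {R : ℝ} (hR : 0 < R) : ν.real (Icc (-R) R) ≤ M * R ^ (1 - ρ) := by
  have hne : {M : ℝ | 0 ≤ M ∧
      ∀ R > (0:ℝ), ν (Icc 0 R) ≤ ENNReal.ofReal (M * R ^ (1 - ρ))}.Nonempty := by
    obtain ⟨M, hM⟩ := h.2
    refine ⟨max M 0, le_max_right _ _, fun R hR => (hM R hR).trans ?_⟩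
    gcongr
    exact le_max_left _ _
  obtain ⟨M', ⟨h0, hM'⟩, hlt⟩ := exists_lt_of_csInf_lt hne hM
  exact (h.measureReal_le h0 hM' hR).trans (by gcongr)

/-- Truncation of the time variable to `[0,T]`. -/
def clampTime (T t : ℝ) : ℝ := max 0 (min t T)

lemma continuous_clampTime (T : ℝ) : Continuous (clampTime T) := by
  unfold clampTime
  fun_prop

lemma clampTime_nonneg (T t : ℝ) : 0 ≤ clampTime T t := le_max_left _ _

lemma clampTime_mem {T : ℝ} (hT : 0 ≤ T) (t : ℝ) : clampTime T t ∈ Icc 0 T :=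
  ⟨le_max_left _ _, max_le hT (min_le_right _ _)⟩

lemma clampTime_eq {T t : ℝ} (ht : t ∈ Icc 0 T) : clampTime T t = t := by
  rw [clampTime, min_eq_left ht.2, max_eq_right ht.1]

section

variable {Kl : ℝ → ℝ → ℝ} {β ρ T c C₀ σ : ℝ} {h0 : Measure ℝ} {H : ℝ → Measure ℝ}

lemma IsMildSolution.isFlow (h : IsMildSolution Kl β ρ T h0 H) (hT : 0 ≤ T) :
    IsFlow fun t => H (clampTime T t) where
  locallyFinite t := (h.1 _ (clampTime_mem hT t)).isLocallyFiniteMeasure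
  bounded R := by
    have hR : 0 < max R 1 := one_pos.trans_le (le_max_right _ _)
    obtain ⟨M, hM⟩ := isCompact_Icc.exists_bound_of_continuousOn
      (h.2.1 (tent (max R 1)) (continuous_tent _)
        (hasCompactSupport_of_abs fun x => tent_eq_zero hR))
    refine ⟨M, fun t => ?_⟩
    have := (h.1 _ (clampTime_mem hT t)).isLocallyFiniteMeasure
    refine le_trans ?_ ((measureReal_le_integral_tent hR).trans
      ((le_abs_self _).trans (hM _ (clampTime_mem hT t))))
    exact measureReal_mono (Icc_subset_Icc (neg_le_neg (le_max_left _ _)) (le_max_left _ _))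
      isCompact_Icc.measure_ne_top
  continuous φ hφ hs :=
    (h.2.1 φ hφ hs).comp_continuous (continuous_clampTime T) (clampTime_mem hT)

lemma IsMildSolution.integral_zero (h : IsMildSolution Kl β ρ T h0 H) (hT : 0 ≤ T) {φ : ℝ → ℝ}
    (hφ : Continuous φ) (hs : HasCompactSupport φ) : ∫ x, φ x ∂H 0 = ∫ x, φ x ∂h0 := by
  rw [h.2.2 0 ⟨le_rfl, hT⟩ φ hφ hs]
  simp

lemma lossRate_rescaledRate {s : ℝ} (hs : s ∈ Icc 0 T) (X : ℝ) :
    lossRate (rescaledRate Kl β (clampTime T)) (β * ρ) (fun t => H (clampTime T t)) X s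
      = Acal Kl β ρ H X s := by
  simp only [lossRate, rescaledRate, Acal, clampTime_eq hs]

lemma integral_Qcal (hb : IsRate (rescaledRate Kl β (clampTime T)) c C₀ σ) {s : ℝ}
    (hs : s ∈ Icc 0 T) [IsLocallyFiniteMeasure (H s)] {ψ : ℝ → ℝ} (hψ : Continuous ψ)
    (hψs : HasCompactSupport ψ) :
    ∫ X, ψ X ∂Qcal Kl β H s
      = gain (rescaledRate Kl β (clampTime T)) (fun t => H (clampTime T t)) ψ s := by
  obtain ⟨R, hR, hψ0⟩ := exists_abs_of_hasCompactSupport hψs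
  have hbc : Continuous fun p : ℝ × ℝ => rescaledRate Kl β (clampTime T) s p.1 p.2 :=
    hb.comp_continuous continuous_const continuous_fst continuous_snd
  have hQ : Qcal Kl β H s = Measure.map (fun p : ℝ × ℝ => p.1 + p.2)
      (((H s).prod (H s)).withDensity fun p =>
        ENNReal.ofReal (rescaledRate Kl β (clampTime T) s p.1 p.2)) := by
    simp only [Qcal, rescaledRate, clampTime_eq hs]
  rw [hQ, integral_map (by fun_prop) hψ.aestronglyMeasurable,
    integral_withDensity_eq_integral_toReal_smul hbc.measurable.ennreal_ofReal
      (.of_forall fun _ => ENNReal.ofReal_lt_top)]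
  simp only [ENNReal.toReal_ofReal (hb.nonneg _ _ _), smul_eq_mul]
  rw [integral_prod]
  · simp only [gain, clampTime_eq hs, mul_comm]
  · refine Continuous.integrable_of_hasCompactSupport (by fun_prop) ?_
    refine hasCompactSupport_uncurry_of_abs (R := R) (R' := R)
      (F := fun Y Z => rescaledRate Kl β (clampTime T) s Y Z * ψ (Y + Z))
      (fun Y Z h => ?_) (fun Y Z h => ?_)
    · rw [mul_comm]
      exact hb.gain_integrand_eq_zero hψ0 (.inl h)
    · rw [mul_comm]
      exact hb.gain_integrand_eq_zero hψ0 (.inr h)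

lemma IsMildSolution.isMildFlow (h : IsMildSolution Kl β ρ T h0 H) (hT : 0 ≤ T)
    (hb : IsRate (rescaledRate Kl β (clampTime T)) c C₀ σ) :
    IsMildFlow (rescaledRate Kl β (clampTime T)) (β * ρ) T fun t => H (clampTime T t) := by
  intro t ht φ hφ hs
  have hA := (h.isFlow hT).continuous_lossRate hb (β * ρ)
  have hdc := continuous_damp hA
  have hdamp : ∀ s ∈ Icc 0 t, ∀ X, exp (-(∫ ξ in s..t, Acal Kl β ρ H X ξ))
      = damp (lossRate (rescaledRate Kl β (clampTime T)) (β * ρ) fun t => H (clampTime T t))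
        X s t := by
    intro s hs X
    rw [damp]
    congr 2
    refine intervalIntegral.integral_congr fun ξ hξ => ?_
    rw [uIcc_of_le hs.2] at hξ
    exact (lossRate_rescaledRate ⟨hs.1.trans hξ.1, hξ.2.trans ht.2⟩ X).symm
  have hψ : ∀ s, Continuous fun X => φ X * damp (lossRate (rescaledRate Kl β (clampTime T))
      (β * ρ) fun t => H (clampTime T t)) X s t := fun s =>
    hφ.mul (hdc.comp (continuous_id.prodMk (continuous_const.prodMk continuous_const)))
  have h00 : (0 : ℝ) ∈ Icc 0 T := ⟨le_rfl, hT⟩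
  simp only [clampTime_eq ht, clampTime_eq h00]
  rw [h.2.2 t ht φ hφ hs, h.integral_zero hT (hψ 0) hs.mul_right]
  congr 1
  · simp only [hdamp 0 ⟨le_rfl, ht.1⟩]
  · refine intervalIntegral.integral_congr fun s hs' => ?_
    rw [uIcc_of_le ht.1] at hs'
    have hsT : s ∈ Icc 0 T := ⟨hs'.1, hs'.2.trans ht.2⟩
    have := (h.1 s hsT).isLocallyFiniteMeasure
    simp only [hdamp s hs']
    exact integral_Qcal hb hsT (hψ s) hs.mul_right

lemma IsMildSolution.measureReal_le (h : IsMildSolution Kl β ρ T h0 H) (hT : 0 ≤ T)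
    (hb : IsRate (rescaledRate Kl β (clampTime T)) c C₀ σ) (hβρ : 0 ≤ β * ρ)
    [IsLocallyFiniteMeasure h0] {M : ℝ}
    (hM : ∀ R, 0 < R → h0.real (Icc (-R) R) ≤ M * R ^ (1 - ρ)) (t : ℝ) {R : ℝ} (hR : 0 < R) :
    (H (clampTime T t)).real (Icc (-R) R)
      ≤ exp (β * ρ * T) * (M * 4 ^ (1 - ρ)) * R ^ (1 - ρ) := by
  have h00 : (0 : ℝ) ∈ Icc 0 T := ⟨le_rfl, hT⟩
  have := (h.1 0 h00).isLocallyFiniteMeasure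
  have ht := clampTime_mem hT t
  have h2R : 0 < 2 * R := by positivity
  have h1 := (h.isMildFlow hT hb).mass_le (h.isFlow hT) hb ht hR
  simp only [clampTime_eq ht, clampTime_eq h00] at h1
  have h2 : (H 0).real (Icc (-(2 * R)) (2 * R)) ≤ M * (4 * R) ^ (1 - ρ) := by
    calc (H 0).real (Icc (-(2 * R)) (2 * R)) ≤ ∫ x, tent (2 * R) x ∂H 0 :=
          measureReal_le_integral_tent h2R
      _ = ∫ x, tent (2 * R) x ∂h0 := h.integral_zero hT (continuous_tent _)
          (hasCompactSupport_of_abs fun x => tent_eq_zero h2R)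
      _ ≤ h0.real (Icc (-(2 * (2 * R))) (2 * (2 * R))) := integral_tent_le_measureReal h2R
      _ ≤ M * (2 * (2 * R)) ^ (1 - ρ) := hM _ (by positivity)
      _ = M * (4 * R) ^ (1 - ρ) := by ring_nf
  calc (H (clampTime T t)).real (Icc (-R) R)
      ≤ exp (β * ρ * clampTime T t) * (H 0).real (Icc (-(2 * R)) (2 * R)) := h1
    _ ≤ exp (β * ρ * T) * (M * (4 * R) ^ (1 - ρ)) := by
        gcongr
        exact ht.2
    _ = exp (β * ρ * T) * (M * 4 ^ (1 - ρ)) * R ^ (1 - ρ) := by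
        rw [mul_rpow (by norm_num) hR.le]
        ring

end

lemma integral_Smap {β t : ℝ} {ν : Measure ℝ} {f : ℝ → ℝ} (hf : Continuous f) :
    ∫ x, f x ∂Smap β t ν = exp (-(β * t)) * ∫ X, f (X * exp (-(β * t))) ∂ν := by
  rw [Smap, integral_smul_measure, integral_map (by fun_prop) hf.aestronglyMeasurable,
    ENNReal.toReal_ofReal (exp_pos _).le, smul_eq_mul]

/-- Weak continuity of the solution map `S_λ(t)` on `𝒳_ρ`: if initial data `h₀ₙ` converge
weakly to `h₀` (tested against continuous compactly supported functions) with uniformly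
bounded `𝒳_ρ`-norms, then `S_λ(t)h₀ₙ ⇀ S_λ(t)h₀` weakly, where `S_λ(t)h₀` is obtained from
the mild solution `H` of the regularized problem via `h(x,t) = H(xe^{βt},t)`. -/
theorem weak_continuity_of_semigroup
    (γ C ρ β lam T t : ℝ) (K : ℝ → ℝ → ℝ) (ζ : ℝ → ℝ)
    (hγ : γ ∈ Ico (0:ℝ) 1) (hC : 0 < C) (hK : KernelHyp K γ C) (hζ : CutoffHyp ζ)
    (hρ : ρ ∈ Ioo γ 1) (hβ : β = 1 / (ρ - γ)) (hlam : lam ∈ Ioo (0:ℝ) (1/2))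
    (hT : 0 < T) (ht : t ∈ Icc (0:ℝ) T)
    (h0 : Measure ℝ) (h0n : ℕ → Measure ℝ)
    (H : ℝ → Measure ℝ) (Hn : ℕ → ℝ → Measure ℝ)
    (hh0 : MemX ρ h0) (hh0n : ∀ n, MemX ρ (h0n n))
    (hbd : ∃ M : ℝ, ∀ n, Xnorm ρ (h0n n) ≤ M)
    (hH : IsMildSolution (Kreg K ζ lam) β ρ T h0 H)
    (hHn : ∀ n, IsMildSolution (Kreg K ζ lam) β ρ T (h0n n) (Hn n))
    (hconv : ∀ f : ℝ → ℝ, Continuous f → HasCompactSupport f →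
      Tendsto (fun n => ∫ x, f x ∂(h0n n)) atTop (𝓝 (∫ x, f x ∂h0))) :
    ∀ f : ℝ → ℝ, Continuous f → HasCompactSupport f →
      Tendsto (fun n => ∫ x, f x ∂(Smap β t (Hn n t))) atTop
        (𝓝 (∫ x, f x ∂(Smap β t (H t)))) := by


  intro f hf hfs
  obtain ⟨M, hM⟩ := hbd
  obtain ⟨M₀, hM₀, hMh0⟩ := hh0.exists_measureReal_le
  have hβ0 : 0 ≤ β := hβ ▸ (one_div_pos.2 (sub_pos.2 hρ.1)).le
  have hβρ : 0 ≤ β * ρ := mul_nonneg hβ0 (hγ.1.trans hρ.1.le)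
  have hσ : 0 ≤ 1 - ρ := sub_nonneg.2 hρ.2.le
  have hb := isRate_rescaledRate hK hC.le hγ.1 hζ hlam.1 (by linarith [hlam.2]) hρ.1.le hβ0
    (continuous_clampTime T) (clampTime_nonneg T)
  have h00 : (0 : ℝ) ∈ Icc 0 T := ⟨le_rfl, hT.le⟩
  have := hh0.isLocallyFiniteMeasure
  have := fun n => (hh0n n).isLocallyFiniteMeasure
  have hM₁ : 0 ≤ max (M + 1) M₀ := hM₀.trans (le_max_right _ _)
  have hg := hH.measureReal_le hT.le hb hβρ (M := max (M + 1) M₀) fun R hR =>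
    (hMh0 R hR).trans (by gcongr; exact le_max_right _ _)
  have hgn := fun n => (hHn n).measureReal_le hT.le hb hβρ (M := max (M + 1) M₀) fun R hR =>
    ((hh0n n).measureReal_le_of_Xnorm_lt ((hM n).trans_lt (lt_add_one M)) hR).trans
      (by gcongr; exact le_max_left _ _)
  have hscale : HasCompactSupport fun X => f (X * exp (-(β * t))) :=
    hfs.comp_homeomorph (Homeomorph.mulRight₀ _ (exp_pos (-(β * t))).ne')
  have key := tendsto_integral_of_isMildFlow hb hβρ hσ (by positivity)
    (fun n => (hHn n).isFlow hT.le) (hH.isFlow hT.le) (fun n => (hHn n).isMildFlow hT.le hb)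
    (hH.isMildFlow hT.le hb) (fun n t _ hR => hgn n t hR) (fun t _ hR => hg t hR)
    (fun φ hφ hφs => by
      simp only [clampTime_eq h00, fun n => (hHn n).integral_zero hT.le hφ hφs,
        hH.integral_zero hT.le hφ hφs]
      exact hconv φ hφ hφs) ht (hf.comp (continuous_mul_const _)) hscale
  simp only [clampTime_eq ht] at key
  simp only [integral_Smap hf]
  exact key.const_mul _

end Smol
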